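/- Assume (A1)–(A4) and λ>0, and let α>0, h*>0, M₁, M₂, M₃ be the constants provided by the lemma on the EPCA approximate solutions (existence, uniqueness and uniform bounds of the EPCA solutions for 0<h<h*). Assume in addition that g(t,u,w)<1 for all t∈[0,α], all u in the closed ball of radius M₁ in ℝⁿ, and all w∈[0,M₁]. Then the impulsive initial value problem has a unique solution (x,τ) on (−∞,α]. Moreover: τ(t)>0 for t∈[0,α]; |x(t)|+τ(t) ≤ M₁ for t∈(−∞,α]; |x(t)−x(t̄)| ≤ M₂|t−t̄| whenever t,t̄ lie in the same interval I_k between consecutive points of {t_{−ℓ₀}=−λ,…,t₀=0,t₁,…,t_{k₀},α} (where t_{k₀} is the last impulsive moment before α); and |τ(t)−τ(t̄)| ≤ M₃|t−t̄| for all t,t̄∈[0,α]. -/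

import Mathlib

open Set Filter MeasureTheory

/-- The piecewise-constant argument `[t]_h = ⌊t/h⌋·h`. -/
noncomputable def flr (h t : ℝ) : ℝ := ⌊t / h⌋ * h

/-- `(x, τ)` is a solution of the EPCA impulsive initial value problem
(with stepsize `h`) on `(-∞, β]`: the initial conditions `x = φ`, `τ = λ`
hold on `(-∞,0]`, `τ` is continuous on `[0,β]` and satisfies the integral
equation with piecewise-constant arguments, `x` is right-continuous, has
left limits at the impulsive moments `tI 1 < ⋯ < tI K` where it jumps by
`Imp k` applied to the left limit, and `x` satisfies the integral equation
with piecewise-constant arguments on every subinterval of `[0,β]` containing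
no impulsive moment. -/
def IsEPCASol (n K : ℕ) (f : ℝ → (Fin n → ℝ) → (Fin n → ℝ) → (Fin n → ℝ))
    (g : ℝ → (Fin n → ℝ) → ℝ → ℝ) (Imp : ℕ → (Fin n → ℝ) → (Fin n → ℝ))
    (φ : ℝ → (Fin n → ℝ)) (lam : ℝ) (tI : ℕ → ℝ)
    (h β : ℝ) (x : ℝ → (Fin n → ℝ)) (τ : ℝ → ℝ) : Prop :=
  (∀ t ≤ (0 : ℝ), x t = φ t) ∧ (∀ t ≤ (0 : ℝ), τ t = lam) ∧
  ContinuousOn τ (Icc 0 β) ∧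
  (∀ t ∈ Icc (0 : ℝ) β,
    τ t = lam + ∫ s in (0 : ℝ)..t, g (flr h s) (x (flr h s)) (τ (flr h s))) ∧
  (∀ t ∈ Icc (0 : ℝ) β, Tendsto x (nhdsWithin t (Ici t)) (nhds (x t))) ∧
  (∀ k, 1 ≤ k → k ≤ K → tI k ≤ β →
    ∃ ξ, Tendsto x (nhdsWithin (tI k) (Iio (tI k))) (nhds ξ) ∧
      x (tI k) = ξ + Imp k ξ) ∧
  (∀ a b : ℝ, 0 ≤ a → a ≤ b → b ≤ β →
    (∀ k, 1 ≤ k → k ≤ K → tI k ∉ Ioc a b) →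
    x b = x a + ∫ s in a..b,
      f (flr h s) (x (flr h s)) (x (flr h s - flr h (τ (flr h s)))))

/-- `(x, τ)` is a solution of the impulsive initial value problem with
state-dependent adaptive delay on `(-∞, β]`. -/
def IsIIVPSol (n K : ℕ) (f : ℝ → (Fin n → ℝ) → (Fin n → ℝ) → (Fin n → ℝ))
    (g : ℝ → (Fin n → ℝ) → ℝ → ℝ) (Imp : ℕ → (Fin n → ℝ) → (Fin n → ℝ))
    (φ : ℝ → (Fin n → ℝ)) (lam : ℝ) (tI : ℕ → ℝ)
    (β : ℝ) (x : ℝ → (Fin n → ℝ)) (τ : ℝ → ℝ) : Prop :=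
  (∀ t ≤ (0 : ℝ), x t = φ t) ∧ (∀ t ≤ (0 : ℝ), τ t = lam) ∧
  ContinuousOn τ (Icc 0 β) ∧
  (∀ t ∈ Icc (0 : ℝ) β, τ t = lam + ∫ s in (0 : ℝ)..t, g s (x s) (τ s)) ∧
  (∀ t ∈ Icc (0 : ℝ) β, Tendsto x (nhdsWithin t (Ici t)) (nhds (x t))) ∧
  (∀ k, 1 ≤ k → k ≤ K → tI k ≤ β →
    ∃ ξ, Tendsto x (nhdsWithin (tI k) (Iio (tI k))) (nhds ξ) ∧
      x (tI k) = ξ + Imp k ξ) ∧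
  (∀ a b : ℝ, 0 ≤ a → a ≤ b → b ≤ β →
    (∀ k, 1 ≤ k → k ≤ K → tI k ∉ Ioc a b) →
    x b = x a + ∫ s in a..b, f s (x s) (x (s - τ s)))

/-- (A1): `f` is continuous on `[0,T]×ℝⁿ×ℝⁿ` and locally Lipschitz
continuous in its second and third arguments. -/
def AssumptionA1 (n : ℕ) (T : ℝ)
    (f : ℝ → (Fin n → ℝ) → (Fin n → ℝ) → (Fin n → ℝ)) : Prop :=
  ContinuousOn (fun p : ℝ × (Fin n → ℝ) × (Fin n → ℝ) => f p.1 p.2.1 p.2.2)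
    (Icc 0 T ×ˢ (univ : Set (Fin n → ℝ)) ×ˢ (univ : Set (Fin n → ℝ))) ∧
  ∀ M : ℝ, 0 < M → ∃ L : ℝ, 0 ≤ L ∧ ∀ t ∈ Icc (0 : ℝ) T,
    ∀ u ub v vb : Fin n → ℝ, ‖u‖ ≤ M → ‖ub‖ ≤ M → ‖v‖ ≤ M → ‖vb‖ ≤ M →
      ‖f t u v - f t ub vb‖ ≤ L * (‖u - ub‖ + ‖v - vb‖)

/-- (A2): `g` is continuous on `[0,T]×ℝⁿ×ℝ`, is positive when its last
argument vanishes, and is locally Lipschitz continuous in its second and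
third arguments. -/
def AssumptionA2 (n : ℕ) (T : ℝ) (g : ℝ → (Fin n → ℝ) → ℝ → ℝ) : Prop :=
  ContinuousOn (fun p : ℝ × (Fin n → ℝ) × ℝ => g p.1 p.2.1 p.2.2)
    (Icc 0 T ×ˢ (univ : Set (Fin n → ℝ)) ×ˢ (univ : Set ℝ)) ∧
  (∀ t ∈ Icc (0 : ℝ) T, ∀ u : Fin n → ℝ, 0 < g t u 0) ∧
  ∀ M : ℝ, 0 < M → ∃ L : ℝ, 0 ≤ L ∧ ∀ t ∈ Icc (0 : ℝ) T,
    ∀ u ub : Fin n → ℝ, ∀ w wb : ℝ, ‖u‖ ≤ M → ‖ub‖ ≤ M → |w| ≤ M → |wb| ≤ M →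
      |g t u w - g t ub wb| ≤ L * (‖u - ub‖ + |w - wb|)

/-- (A3): the impulse functions `I_k`, `k = 1,…,K`, are globally Lipschitz
continuous with a common Lipschitz constant. -/
def AssumptionA3 (n K : ℕ) (Imp : ℕ → (Fin n → ℝ) → (Fin n → ℝ)) : Prop :=
  ∃ L : ℝ, 0 ≤ L ∧ ∀ k, 1 ≤ k → k ≤ K → ∀ u ub : Fin n → ℝ,
    ‖Imp k u - Imp k ub‖ ≤ L * ‖u - ub‖

/-- (A4): the initial function `φ` is bounded on `(-∞,0]` and locally
piecewise Lipschitz continuous, with possible jump discontinuities only at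
the points of the strictly decreasing sequence `0 = tm 0 > tm 1 > ⋯ → -∞`,
where it is right-continuous. -/
def AssumptionA4 (n : ℕ) (φ : ℝ → (Fin n → ℝ)) (tm : ℕ → ℝ) : Prop :=
  tm 0 = 0 ∧ StrictAnti tm ∧ Tendsto tm atTop atBot ∧
  (∀ k : ℕ, Tendsto φ (nhdsWithin (tm k) (Ioi (tm k))) (nhds (φ (tm k)))) ∧
  (∃ N : ℝ, 0 ≤ N ∧ ∀ s ≤ (0 : ℝ), ‖φ s‖ ≤ N) ∧
  (∀ M : ℝ, 0 < M → ∃ L : ℝ, 0 ≤ L ∧ ∀ k : ℕ,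
    ∀ s ∈ Ico (tm (k + 1)) (tm k) ∩ Icc (-M) 0,
    ∀ sb ∈ Ico (tm (k + 1)) (tm k) ∩ Icc (-M) 0,
      ‖φ s - φ sb‖ ≤ L * |s - sb|)

lemma flr_le {h : ℝ} (hh : 0 < h) (t : ℝ) : flr h t ≤ t := by
  have := Int.floor_le (t / h)
  rwa [le_div_iff₀ hh] at this

lemma sub_lt_flr {h : ℝ} (hh : 0 < h) (t : ℝ) : t - h < flr h t := by
  have := Int.lt_floor_add_one (t / h)
  rw [div_lt_iff₀ hh] at this
  unfold flr
  linarith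

lemma flr_nonneg {h : ℝ} (hh : 0 < h) {t : ℝ} (ht : 0 ≤ t) : 0 ≤ flr h t := by
  have : (0 : ℤ) ≤ ⌊t / h⌋ := Int.floor_nonneg.2 (by positivity)
  have : (0 : ℝ) ≤ (⌊t / h⌋ : ℝ) := by exact_mod_cast this
  exact mul_nonneg this hh.le

/-- Rounding down with a mesh tending to zero does not change limits. -/
lemma tendsto_flr {h : ℕ → ℝ} (hh : ∀ j, 0 < h j) (hlim : Tendsto h atTop (nhds 0))
    {u : ℕ → ℝ} {l : ℝ} (hu : Tendsto u atTop (nhds l)) :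
    Tendsto (fun j => flr (h j) (u j)) atTop (nhds l) := by
  have h1 : Tendsto (fun j => u j - h j) atTop (nhds l) := by simpa using hu.sub hlim
  exact tendsto_of_tendsto_of_tendsto_of_le_of_le h1 hu
    (fun j => (sub_lt_flr (hh j) _).le) (fun j => flr_le (hh j) _)

lemma measurable_comp_flr {β : Type*} [MeasurableSpace β] (h : ℝ) (G : ℝ → β) :
    Measurable fun s => G (flr h s) :=
  (measurable_from_top (f := fun m : ℤ => G (m * h))).comp
    (Int.measurable_floor.comp (measurable_id.div_const h))

/-- The points at which solutions may fail to be continuous. -/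
def breakpoints (K : ℕ) (tI tm : ℕ → ℝ) : Set ℝ := tI '' Icc 1 K ∪ range tm

lemma countable_breakpoints (K : ℕ) (tI tm : ℕ → ℝ) : (breakpoints K tI tm).Countable :=
  (((finite_Icc 1 K).image tI).countable).union (countable_range tm)

lemma finite_breakpoints_inter_Ici (K : ℕ) (tI : ℕ → ℝ) {tm : ℕ → ℝ}
    (htm : Tendsto tm atTop atBot) (c : ℝ) : (breakpoints K tI tm ∩ Ici c).Finite := by
  obtain ⟨N, hN⟩ := eventually_atTop.1 (htm.eventually_lt_atBot c)
  refine (((finite_Icc 1 K).image tI).union ((finite_Iio N).image tm)).subset ?_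
  rintro b ⟨hb | ⟨k, rfl⟩, hc⟩
  · exact Or.inl hb
  · refine Or.inr ⟨k, ?_, rfl⟩
    by_contra hk
    exact absurd (hN k (not_lt.1 hk)) (not_lt.2 hc)

lemma exists_gap {B : Set ℝ} (hB : ∀ c, (B ∩ Ici c).Finite) (t : ℝ) :
    ∃ δ > 0, ∀ b ∈ B, b ∈ Icc (t - δ) (t + δ) → b = t := by
  have hfin : ((B ∩ Ici (t - 1)) \ {t}).Finite := (hB _).subset sdiff_subset
  have hmem : ((B ∩ Ici (t - 1)) \ {t})ᶜ ∈ nhds t :=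
    hfin.isClosed.isOpen_compl.mem_nhds (by simp)
  obtain ⟨ε, hε, hsub⟩ := Metric.mem_nhds_iff.1 hmem
  refine ⟨min (ε / 2) 1, by positivity, fun b hb hbt => ?_⟩
  by_contra hne
  have h1 := min_le_left (ε / 2) 1
  have h2 := min_le_right (ε / 2) 1
  have hball : b ∈ Metric.ball t ε := by
    rw [Metric.mem_ball, Real.dist_eq, abs_lt]
    constructor <;> linarith [hbt.1, hbt.2]
  have hge : t - 1 ≤ b := by linarith [hbt.1]
  exact hsub hball ⟨⟨hb, hge⟩, hne⟩

/-- `x` is Lipschitz with constant `M` on the subintervals of `[m, α]` without points of `B`,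
the left endpoint not being counted. -/
def LipschitzOff {n : ℕ} (B : Set ℝ) (M m α : ℝ) (x : ℝ → Fin n → ℝ) : Prop :=
  ∀ s t, m ≤ s → s ≤ t → t ≤ α → (∀ b ∈ B, b ∉ Ioc s t) → ‖x t - x s‖ ≤ M * (t - s)

/-- Pointwise convergence of uniformly piecewise Lipschitz functions at a point off `B` persists
along converging arguments. -/
lemma LipschitzOff.tendsto_comp {n : ℕ} {B : Set ℝ} (hB : ∀ c, (B ∩ Ici c).Finite)
    {M m α : ℝ} {X : ℕ → ℝ → Fin n → ℝ} (hX : ∀ j, LipschitzOff B M m α (X j))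
    {s : ℝ} (hm : m < s) (hs : s ≤ α) (hsB : s ∉ B) {l : Fin n → ℝ}
    (hlim : Tendsto (fun j => X j s) atTop (nhds l)) {r : ℕ → ℝ}
    (hr : Tendsto r atTop (nhds s)) (hrα : ∀ j, r j ≤ α) :
    Tendsto (fun j => X j (r j)) atTop (nhds l) := by
  obtain ⟨δ, hδ, hgap⟩ := exists_gap hB s
  have hev : ∀ᶠ j in atTop, ‖X j (r j) - X j s‖ ≤ M * |r j - s| := by
    filter_upwards [hr.eventually (eventually_gt_nhds hm),
      hr.eventually (Icc_mem_nhds (by linarith : s - δ < s) (by linarith : s < s + δ))]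
      with j h1 h2
    have hno : ∀ b ∈ B, b ∉ Icc (s - δ) (s + δ) := fun b hb hbI => hsB (hgap b hb hbI ▸ hb)
    rcases le_total (r j) s with h | h
    · rw [norm_sub_rev, abs_sub_comm, abs_of_nonneg (by linarith)]
      exact hX j _ _ h1.le h hs fun b hb hbI => hno b hb ⟨by linarith [h2.1, hbI.1],
        by linarith [hbI.2]⟩
    · rw [abs_of_nonneg (by linarith)]
      exact hX j _ _ hm.le h (hrα j) fun b hb hbI => hno b hb ⟨by linarith [hbI.1],
        by linarith [h2.2, hbI.2]⟩
  have h0 : Tendsto (fun j => M * |r j - s|) atTop (nhds 0) := by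
    have : Tendsto (fun j => M * |r j - s|) atTop (nhds (M * |s - s|)) :=
      ((hr.sub_const s).abs).const_mul M
    simpa using this
  have := (squeeze_zero_norm' hev h0).add hlim
  simpa using this

/-- A sequence that is uniformly approximated by convergent sequences converges. -/
lemma exists_tendsto_of_approx {E : Type*} [NormedAddCommGroup E] [CompleteSpace E] {u : ℕ → E}
    (h : ∀ ε > 0, ∃ v : ℕ → E, (∃ l, Tendsto v atTop (nhds l)) ∧ ∀ j, ‖u j - v j‖ ≤ ε) :
    ∃ l, Tendsto u atTop (nhds l) := by
  apply cauchySeq_tendsto_of_complete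
  rw [Metric.cauchySeq_iff']
  intro ε hε
  obtain ⟨v, ⟨l, hl⟩, hv⟩ := h (ε / 4) (by linarith)
  obtain ⟨N, hN⟩ := Metric.cauchySeq_iff'.1 hl.cauchySeq (ε / 4) (by linarith)
  refine ⟨N, fun j hj => ?_⟩
  have h1 := hv j
  have h2 := hv N
  have h3 := hN j hj
  rw [← dist_eq_norm] at h1 h2
  have := dist_triangle4_right (u j) (u N) (v j) (v N)
  linarith

/-- Pointwise bounded sequences of functions on a countable set have pointwise convergent
subsequences. -/
lemma exists_subseq_tendsto_of_bounded {ι E : Type*} [Countable ι] [NormedAddCommGroup E]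
    [ProperSpace E] {u : ℕ → ι → E} {M : ℝ} (hu : ∀ j i, ‖u j i‖ ≤ M) :
    ∃ ψ : ℕ → ℕ, StrictMono ψ ∧ ∀ i, ∃ l, Tendsto (fun j => u (ψ j) i) atTop (nhds l) := by
  have hc : IsCompact (univ.pi fun _ : ι => Metric.closedBall (0 : E) M) :=
    isCompact_univ_pi fun _ => isCompact_closedBall _ _
  obtain ⟨a, -, ψ, hψ, hlim⟩ := hc.tendsto_subseq (x := u) fun j i _ => by simpa using hu j i
  exact ⟨ψ, hψ, fun i => ⟨a i, (tendsto_pi_nhds.1 hlim) i⟩⟩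

/-- A bounded sequence of uniformly piecewise Lipschitz functions that agree on `(-∞, 0]` has a
pointwise convergent subsequence. -/
lemma exists_subseq_tendsto {n : ℕ} {B : Set ℝ} (hB : ∀ c, (B ∩ Ici c).Finite)
    {M1 M2 M3 m α lam : ℝ} (hm : m ≤ 0) (hα : 0 < α) (hαB : α ∉ B) (hM2 : 0 ≤ M2) (hM3 : 0 ≤ M3)
    {X : ℕ → ℝ → Fin n → ℝ} {Θ : ℕ → ℝ → ℝ} {φ : ℝ → Fin n → ℝ}
    (hX0 : ∀ j, ∀ t ≤ 0, X j t = φ t) (hΘ0 : ∀ j, ∀ t ≤ 0, Θ j t = lam)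
    (hX : ∀ j, LipschitzOff B M2 m α (X j))
    (hΘ : ∀ j, ∀ t ∈ Icc 0 α, ∀ s ∈ Icc 0 α, |Θ j t - Θ j s| ≤ M3 * |t - s|)
    (hbX : ∀ j, ∀ t ≤ α, ‖X j t‖ ≤ M1) (hbΘ : ∀ j, ∀ t ≤ α, |Θ j t| ≤ M1) :
    ∃ (ψ : ℕ → ℕ) (x : ℝ → Fin n → ℝ) (τ : ℝ → ℝ), StrictMono ψ ∧
      ∀ t ≤ α, Tendsto (fun j => X (ψ j) t) atTop (nhds (x t)) ∧
        Tendsto (fun j => Θ (ψ j) t) atTop (nhds (τ t)) := by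
  have hD : {t : ℝ | t ≤ α ∧ (t ∈ range ((↑) : ℚ → ℝ) ∨ t = α)}.Countable :=
    ((countable_range _).union (countable_singleton α)).mono fun t ht => ht.2
  have := hD.to_subtype
  obtain ⟨ψ, hψ, hlim⟩ := exists_subseq_tendsto_of_bounded
    (u := fun j (t : {t : ℝ | t ≤ α ∧ (t ∈ range ((↑) : ℚ → ℝ) ∨ t = α)}) => (X j t, Θ j t))
    (M := M1) fun j t => max_le (hbX j t t.2.1) (hbΘ j t t.2.1)
  have hlimX : ∀ t ≤ α, (t ∈ range ((↑) : ℚ → ℝ) ∨ t = α) →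
      (∃ l, Tendsto (fun j => X (ψ j) t) atTop (nhds l)) ∧
        ∃ l, Tendsto (fun j => Θ (ψ j) t) atTop (nhds l) := by
    intro t ht ht'
    obtain ⟨l, hl⟩ := hlim ⟨t, ht, ht'⟩
    exact ⟨⟨l.1, (continuous_fst.tendsto l).comp hl⟩, ⟨l.2, (continuous_snd.tendsto l).comp hl⟩⟩
  have key : ∀ t ≤ α, (∃ l, Tendsto (fun j => X (ψ j) t) atTop (nhds l)) ∧
        ∃ l, Tendsto (fun j => Θ (ψ j) t) atTop (nhds l) := by
    intro t ht
    rcases le_or_gt t 0 with h0 | h0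
    · refine ⟨⟨φ t, ?_⟩, ⟨lam, ?_⟩⟩
      · simp only [hX0 _ t h0, tendsto_const_nhds]
      · simp only [hΘ0 _ t h0, tendsto_const_nhds]
    rcases eq_or_lt_of_le ht with rfl | hlt
    · exact hlimX t le_rfl (Or.inr rfl)
    obtain ⟨δ, hδ, hgap⟩ := exists_gap hB t
    have hex : ∀ M ≥ 0, ∀ ε > 0, ∃ q : ℚ, t < q ∧ (q : ℝ) ≤ α ∧ (q : ℝ) < t + δ ∧
        M * (q - t) ≤ ε := by
      intro M hM ε hε
      obtain ⟨q, hq1, hq2⟩ := exists_rat_btwn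
        (show t < min α (min (t + δ) (t + ε / (M + 1))) by
          have : 0 < ε / (M + 1) := by positivity
          simp only [lt_min_iff]
          exact ⟨hlt, by linarith, by linarith⟩)
      simp only [lt_min_iff] at hq2
      refine ⟨q, hq1, hq2.1.le, hq2.2.1, ?_⟩
      calc M * (q - t) ≤ (M + 1) * (ε / (M + 1)) := by
            apply mul_le_mul <;> linarith [hq2.2.2]
        _ = ε := by field_simp
    constructor
    · refine exists_tendsto_of_approx fun ε hε => ?_
      obtain ⟨q, h1, h2, h3, h4⟩ := hex M2 hM2 ε hε
      refine ⟨fun j => X (ψ j) q, (hlimX q h2 (Or.inl ⟨q, rfl⟩)).1, fun j => ?_⟩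
      rw [norm_sub_rev]
      refine (hX _ t q (by linarith) h1.le h2 fun b hb hbI => ?_).trans h4
      have := hgap b hb ⟨by linarith [hbI.1], by linarith [hbI.2]⟩
      exact absurd hbI.1 (by rw [this]; exact lt_irrefl _)
    · refine exists_tendsto_of_approx fun ε hε => ?_
      obtain ⟨q, h1, h2, h3, h4⟩ := hex M3 hM3 ε hε
      refine ⟨fun j => Θ (ψ j) q, (hlimX q h2 (Or.inl ⟨q, rfl⟩)).2, fun j => ?_⟩
      have := hΘ (ψ j) q ⟨by linarith, h2⟩ t ⟨h0.le, ht⟩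
      rw [abs_of_pos (by linarith : (0 : ℝ) < q - t), abs_sub_comm] at this
      exact this.trans h4
  choose! x hx using fun t ht => (key t ht).1
  choose! τ hτ using fun t ht => (key t ht).2
  exact ⟨ψ, x, τ, hψ, fun t ht => ⟨hx t ht, hτ t ht⟩⟩

lemma AssumptionA1.exists_bound {n : ℕ} {T : ℝ} {f : ℝ → (Fin n → ℝ) → (Fin n → ℝ) → (Fin n → ℝ)}
    (hf : AssumptionA1 n T f) (M : ℝ) :
    ∃ C, 0 ≤ C ∧ ∀ t ∈ Icc 0 T, ∀ u v, ‖u‖ ≤ M → ‖v‖ ≤ M → ‖f t u v‖ ≤ C := by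
  obtain ⟨C, hC⟩ := ((isCompact_Icc (a := (0 : ℝ)) (b := T)).prod
    ((isCompact_closedBall (0 : Fin n → ℝ) M).prod
      (isCompact_closedBall (0 : Fin n → ℝ) M))).exists_bound_of_continuousOn
    (hf.1.mono (prod_mono le_rfl (prod_mono (subset_univ _) (subset_univ _))))
  exact ⟨max C 0, le_max_right _ _, fun t ht u v hu hv =>
    (hC (t, u, v) ⟨ht, by simpa using hu, by simpa using hv⟩).trans (le_max_left _ _)⟩

lemma AssumptionA2.exists_bound {n : ℕ} {T : ℝ} {g : ℝ → (Fin n → ℝ) → ℝ → ℝ}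
    (hg : AssumptionA2 n T g) (M : ℝ) :
    ∃ C, 0 ≤ C ∧ ∀ t ∈ Icc 0 T, ∀ u w, ‖u‖ ≤ M → |w| ≤ M → ‖g t u w‖ ≤ C := by
  obtain ⟨C, hC⟩ := ((isCompact_Icc (a := (0 : ℝ)) (b := T)).prod
    ((isCompact_closedBall (0 : Fin n → ℝ) M).prod
      (isCompact_closedBall (0 : ℝ) M))).exists_bound_of_continuousOn
    (hg.1.mono (prod_mono le_rfl (prod_mono (subset_univ _) (subset_univ _))))
  exact ⟨max C 0, le_max_right _ _, fun t ht u v hu hv =>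
    (hC (t, u, v) ⟨ht, by simpa using hu, by simpa using hv⟩).trans (le_max_left _ _)⟩

lemma AssumptionA1.tendsto {n : ℕ} {T : ℝ} {f : ℝ → (Fin n → ℝ) → (Fin n → ℝ) → (Fin n → ℝ)}
    (hf : AssumptionA1 n T f) {ι : Type*} {l : Filter ι} {a : ι → ℝ} {u v : ι → Fin n → ℝ}
    {a₀ : ℝ} {u₀ v₀ : Fin n → ℝ} (ha₀ : a₀ ∈ Icc 0 T) (hmem : ∀ᶠ i in l, a i ∈ Icc 0 T)
    (ha : Tendsto a l (nhds a₀)) (hu : Tendsto u l (nhds u₀)) (hv : Tendsto v l (nhds v₀)) :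
    Tendsto (fun i => f (a i) (u i) (v i)) l (nhds (f a₀ u₀ v₀)) :=
  (hf.1 (a₀, u₀, v₀) ⟨ha₀, mem_univ _, mem_univ _⟩).tendsto.comp
    (tendsto_nhdsWithin_iff.2 ⟨ha.prodMk_nhds (hu.prodMk_nhds hv),
      hmem.mono fun _ h => ⟨h, mem_univ _, mem_univ _⟩⟩)

lemma AssumptionA2.tendsto {n : ℕ} {T : ℝ} {g : ℝ → (Fin n → ℝ) → ℝ → ℝ}
    (hg : AssumptionA2 n T g) {ι : Type*} {l : Filter ι} {a w : ι → ℝ} {u : ι → Fin n → ℝ}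
    {a₀ w₀ : ℝ} {u₀ : Fin n → ℝ} (ha₀ : a₀ ∈ Icc 0 T) (hmem : ∀ᶠ i in l, a i ∈ Icc 0 T)
    (ha : Tendsto a l (nhds a₀)) (hu : Tendsto u l (nhds u₀)) (hw : Tendsto w l (nhds w₀)) :
    Tendsto (fun i => g (a i) (u i) (w i)) l (nhds (g a₀ u₀ w₀)) :=
  (hg.1 (a₀, u₀, w₀) ⟨ha₀, mem_univ _, mem_univ _⟩).tendsto.comp
    (tendsto_nhdsWithin_iff.2 ⟨ha.prodMk_nhds (hu.prodMk_nhds hw),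
      hmem.mono fun _ h => ⟨h, mem_univ _, mem_univ _⟩⟩)

lemma exists_mem_Ico_succ {u : ℕ → ℝ} {t : ℝ} (h0 : u 0 ≤ t) (N : ℕ) (hN : t < u (N + 1)) :
    ∃ k ≤ N, t ∈ Ico (u k) (u (k + 1)) := by
  induction N with
  | zero => exact ⟨0, le_rfl, h0, hN⟩
  | succ N ih =>
    rcases lt_or_ge t (u (N + 1)) with h | h
    · obtain ⟨k, hk, hmem⟩ := ih h
      exact ⟨k, by omega, hmem⟩
    · exact ⟨N + 1, le_rfl, h, hN⟩

lemma exists_mem_Ico_of_tendsto_atBot {u : ℕ → ℝ} (hu : Tendsto u atTop atBot) {t : ℝ}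
    (h0 : t < u 0) : ∃ k, t ∈ Ico (u (k + 1)) (u k) := by
  classical
  have hex : ∃ k, u k ≤ t := (hu.eventually_le_atBot t).exists
  obtain ⟨k, hk⟩ : ∃ k, Nat.find hex = k + 1 := Nat.exists_eq_succ_of_ne_zero fun h =>
    absurd (Nat.find_spec hex) (by rw [h]; exact not_le.2 h0)
  refine ⟨k, hk ▸ Nat.find_spec hex, not_le.1 (Nat.find_min hex ?_)⟩
  omega

/-- The Lipschitz estimates of an approximate solution, combined into a single one which includes
the right end of the time interval. -/
lemma IsEPCASol.lipschitzOff {n K : ℕ} {T lam : ℝ}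
    {f : ℝ → (Fin n → ℝ) → (Fin n → ℝ) → (Fin n → ℝ)}
    {g : ℝ → (Fin n → ℝ) → ℝ → ℝ} {Imp : ℕ → (Fin n → ℝ) → (Fin n → ℝ)}
    {φ : ℝ → (Fin n → ℝ)} {tm tI : ℕ → ℝ} {h α M1 M2 : ℝ} {x : ℝ → Fin n → ℝ} {τ : ℝ → ℝ}
    (hsol : IsEPCASol n K f g Imp φ lam tI h α x τ) (hh : 0 < h)
    (hf : AssumptionA1 n T f) (htm0 : tm 0 = 0) (htm : Tendsto tm atTop atBot)
    (htI0 : tI 0 = 0) (htIK : tI (K + 1) = T) (hαT : α ≤ T) (hM2 : 0 ≤ M2)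
    (hpos : ∀ t ∈ Icc (0 : ℝ) α, 0 ≤ τ t) (hx : ∀ t ≤ α, ‖x t‖ ≤ M1)
    (hLip : ∀ k ≤ K, ∀ t ∈ Ico (tI k) (tI (k + 1)) ∩ Icc 0 α,
      ∀ tb ∈ Ico (tI k) (tI (k + 1)) ∩ Icc 0 α, ‖x t - x tb‖ ≤ M2 * |t - tb|)
    (hLip' : ∀ k : ℕ, ∀ t ∈ Ico (tm (k + 1)) (tm k) ∩ Icc (-M1) 0,
      ∀ tb ∈ Ico (tm (k + 1)) (tm k) ∩ Icc (-M1) 0, ‖x t - x tb‖ ≤ M2 * |t - tb|) :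
    LipschitzOff (breakpoints K tI tm) M2 (-M1) α x := by
  intro s t hs hst ht hno
  rcases eq_or_lt_of_le hst with rfl | hlt
  · simp
  have habs : |t - s| = t - s := abs_of_pos (by linarith)
  have hnoI : ∀ k, 1 ≤ k → k ≤ K → tI k ∉ Ioc s t := fun k h1 h2 =>
    hno _ (Or.inl ⟨k, ⟨h1, h2⟩, rfl⟩)
  have hnom : ∀ k, tm k ∉ Ioc s t := fun k => hno _ (Or.inr ⟨k, rfl⟩)
  rcases lt_or_ge s 0 with h0 | h0
  · obtain ⟨k, hk1, hk2⟩ := exists_mem_Ico_of_tendsto_atBot htm (t := s) (by linarith)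
    have htk : t < tm k := not_le.1 fun h => hnom k ⟨hk2, h⟩
    have ht0 : t < 0 := not_le.1 fun h => hnom 0 ⟨by linarith, by linarith⟩
    have := hLip' k t ⟨⟨by linarith, htk⟩, by linarith, ht0.le⟩ s
      ⟨⟨hk1, hk2⟩, hs, h0.le⟩
    rwa [habs] at this
  · obtain ⟨k, hk, hk1, hk2⟩ := exists_mem_Ico_succ (u := tI) (t := s) (by linarith) K
      (by linarith)
    rcases lt_or_ge t (tI (k + 1)) with hlt1 | hge1
    · have := hLip k hk t ⟨⟨by linarith, hlt1⟩, by linarith, ht⟩ s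
        ⟨⟨hk1, hk2⟩, h0, by linarith⟩
      rwa [habs] at this
    · have hkK : k = K := by
        by_contra hne
        exact hnoI (k + 1) (by omega) (by omega) ⟨hk2, hge1⟩
      subst hkK
      obtain ⟨C, -, hC⟩ := hf.exists_bound M1
      have hest : ∀ a ∈ Ioo s t, ‖x t - x s‖ ≤ C * (t - a) + M2 * (t - s) := by
        intro a ha
        have h1 : ‖x t - x a‖ ≤ C * (t - a) := by
          rw [hsol.2.2.2.2.2.2 a t (by linarith [ha.1]) ha.2.le ht fun k h1 h2 hmem =>
            hnoI k h1 h2 ⟨by linarith [ha.1, hmem.1], hmem.2⟩, add_sub_cancel_left]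
          have := intervalIntegral.norm_integral_le_of_norm_le_const (a := a) (b := t) (C := C)
            (f := fun s => f (flr h s) (x (flr h s)) (x (flr h s - flr h (τ (flr h s)))))
            fun r hr => ?_
          · rwa [abs_of_pos (by linarith [ha.2])] at this
          rw [uIoc_of_le ha.2.le] at hr
          have hr0 : 0 ≤ r := by linarith [hr.1, ha.1]
          have hf0 := flr_nonneg hh hr0
          have hf1 := flr_le hh r
          have hτ := flr_nonneg hh (hpos _ ⟨hf0, by linarith [hr.2]⟩)
          exact hC _ ⟨hf0, by linarith [hr.2]⟩ _ _ (hx _ (by linarith [hr.2]))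
            (hx _ (by linarith [hr.2]))
        have h2 : ‖x a - x s‖ ≤ M2 * |a - s| := hLip k le_rfl a
          ⟨⟨by linarith [ha.1], by linarith [ha.2]⟩, by linarith [ha.1], by linarith [ha.2]⟩ s
          ⟨⟨hk1, hk2⟩, h0, by linarith⟩
        rw [abs_of_pos (by linarith [ha.1])] at h2
        have h3 : M2 * (a - s) ≤ M2 * (t - s) :=
          mul_le_mul_of_nonneg_left (by linarith [ha.2]) hM2
        have := norm_sub_le_norm_sub_add_norm_sub (x t) (x a) (x s)
        linarith
      have hlim : Tendsto (fun a => C * (t - a) + M2 * (t - s)) (nhdsWithin t (Iio t))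
          (nhds (M2 * (t - s))) := by
        have : Continuous fun a => C * (t - a) + M2 * (t - s) := by fun_prop
        simpa using (this.tendsto t).mono_left nhdsWithin_le_nhds
      refine ge_of_tendsto hlim ?_
      filter_upwards [Ioo_mem_nhdsLT hlt] with a ha using hest a ha

lemma AssumptionA2.exists_pos_le {n : ℕ} {T : ℝ} {g : ℝ → (Fin n → ℝ) → ℝ → ℝ}
    (hg : AssumptionA2 n T g) (M : ℝ) :
    ∃ m > 0, ∀ t ∈ Icc 0 T, ∀ u, ‖u‖ ≤ M → m ≤ g t u 0 := by
  have hcont : ContinuousOn (fun p : ℝ × (Fin n → ℝ) => g p.1 p.2 0)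
      (Icc 0 T ×ˢ Metric.closedBall 0 M) :=
    hg.1.comp (f := fun p : ℝ × (Fin n → ℝ) => (p.1, p.2, (0 : ℝ))) (by fun_prop)
      fun p hp => ⟨hp.1, mem_univ _, mem_univ _⟩
  obtain ⟨m, hm, hle⟩ := (isCompact_Icc.prod (isCompact_closedBall _ _)).exists_forall_le'
    hcont (a := 0) fun p hp => hg.2.1 p.1 hp.1 p.2
  exact ⟨m, hm, fun t ht u hu => hle (t, u) ⟨ht, by simpa using hu⟩⟩

/-- A nonnegative solution of the delay equation never vanishes. -/
lemma AssumptionA2.pos_of_integral_eq {n : ℕ} {T α lam M : ℝ} {g : ℝ → (Fin n → ℝ) → ℝ → ℝ}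
    (hg : AssumptionA2 n T g) (hαT : α ≤ T) (hlam : 0 < lam) {x : ℝ → Fin n → ℝ} {τ : ℝ → ℝ}
    (hτc : ContinuousOn τ (Icc 0 α)) (hτ0 : ∀ t ∈ Icc 0 α, 0 ≤ τ t)
    (hx : ∀ t ∈ Icc 0 α, ‖x t‖ ≤ M)
    (hG : IntervalIntegrable (fun s => g s (x s) (τ s)) volume 0 α)
    (heq : ∀ t ∈ Icc 0 α, τ t = lam + ∫ s in (0 : ℝ)..t, g s (x s) (τ s)) :
    ∀ t ∈ Icc 0 α, 0 < τ t := by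
  intro t ht
  refine (hτ0 t ht).lt_of_ne fun hzero => ?_
  have ht0 : 0 < t := by
    refine ht.1.lt_of_ne fun h => ?_
    have := heq t ht
    rw [← hzero, ← h, intervalIntegral.integral_same] at this
    linarith
  obtain ⟨m, hm, hmle⟩ := hg.exists_pos_le M
  have hM : 0 ≤ M := (norm_nonneg _).trans (hx t ht)
  obtain ⟨L, hL, hLip⟩ := hg.2.2 (M + 1) (by linarith)
  obtain ⟨ε, hε, hsub⟩ := Metric.mem_nhdsWithin_iff.1 ((hτc t ht).eventually
    (gt_mem_nhds (show τ t < min 1 (m / (L + 1)) by rw [← hzero]; positivity)))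
  obtain ⟨a, ha, hat⟩ := exists_between (show max 0 (t - ε) < t from
    max_lt ht0 (by linarith))
  have ha0 := (le_max_left _ _).trans_lt ha
  have haε := (le_max_right _ _).trans_lt ha
  have hGpos : ∀ s ∈ Ioo a t, 0 < g s (x s) (τ s) := by
    intro s hs
    have hsI : s ∈ Icc 0 α := ⟨by linarith [hs.1], by linarith [hs.2, ht.2]⟩
    have hsT : s ∈ Icc 0 T := ⟨hsI.1, hsI.2.trans hαT⟩
    have hsm : τ s < min 1 (m / (L + 1)) := hsub ⟨by
      rw [Metric.mem_ball, Real.dist_eq, abs_lt]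
      constructor <;> linarith [hs.1, hs.2], hsI⟩
    have h1 := hmle s hsT (x s) (hx s hsI)
    have hτs := hτ0 s hsI
    have h2 := hLip s hsT (x s) (x s) (τ s) 0 (by linarith [hx s hsI]) (by linarith [hx s hsI])
      (by rw [abs_of_nonneg hτs]; linarith [hsm.trans_le (min_le_left _ _)])
      (by rw [abs_zero]; linarith)
    rw [sub_self, norm_zero, zero_add, sub_zero, abs_of_nonneg hτs] at h2
    have h3 := hsm.trans_le (min_le_right _ _)
    rw [lt_div_iff₀ (by linarith)] at h3
    have h4 := (abs_le.1 h2).1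
    nlinarith
  have haI : a ∈ Icc 0 α := ⟨ha0.le, by linarith [ht.2]⟩
  have hint : ∀ s ∈ Icc 0 α, IntervalIntegrable (fun s => g s (x s) (τ s)) volume 0 s :=
    fun s hs => hG.mono_set (by
      rw [uIcc_of_le hs.1, uIcc_of_le (hs.1.trans hs.2)]; exact Icc_subset_Icc le_rfl hs.2)
  have hdiff := intervalIntegral.integral_interval_sub_left (hint t ht) (hint a haI)
  have hpos := intervalIntegral.intervalIntegral_pos_of_pos_on
    ((hint a haI).symm.trans (hint t ht)) hGpos hat
  have h1 := heq t ht
  have h2 := heq a haI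
  have h3 := hτ0 a haI
  linarith

/-- Along a solution of the delay equation with `g < 1`, the delayed time is increasing. -/
lemma strictMonoOn_sub_delay {α lam : ℝ} {G τ : ℝ → ℝ}
    (hG : IntervalIntegrable G volume 0 α) (hG1 : ∀ t ∈ Icc 0 α, G t < 1)
    (heq : ∀ t ∈ Icc 0 α, τ t = lam + ∫ s in (0 : ℝ)..t, G s) :
    StrictMonoOn (fun t => t - τ t) (Icc 0 α) := by
  intro a ha b hb hab
  have hint : ∀ s ∈ Icc 0 α, IntervalIntegrable G volume 0 s :=
    fun s hs => hG.mono_set (by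
      rw [uIcc_of_le hs.1, uIcc_of_le (hs.1.trans hs.2)]; exact Icc_subset_Icc le_rfl hs.2)
  have hdiff := intervalIntegral.integral_interval_sub_left (hint b hb) (hint a ha)
  have hGab := (hint a ha).symm.trans (hint b hb)
  have hpos := intervalIntegral.intervalIntegral_pos_of_pos_on
    ((intervalIntegrable_const (c := (1 : ℝ))).sub hGab)
    (fun s hs => sub_pos.2 (hG1 s ⟨by linarith [ha.1, hs.1], by linarith [hb.2, hs.2]⟩)) hab
  rw [intervalIntegral.integral_sub intervalIntegrable_const hGab,
    intervalIntegral.integral_const, smul_eq_mul, mul_one] at hpos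
  have h1 := heq a ha
  have h2 := heq b hb
  simp only
  linarith

/-- The conclusion of the existence part: a solution with the required bounds, together with
the integrability of the right-hand side of the delay equation. -/
structure IsRegularSol (n K : ℕ) (f : ℝ → (Fin n → ℝ) → (Fin n → ℝ) → (Fin n → ℝ))
    (g : ℝ → (Fin n → ℝ) → ℝ → ℝ) (Imp : ℕ → (Fin n → ℝ) → (Fin n → ℝ))
    (φ : ℝ → (Fin n → ℝ)) (lam : ℝ) (tI tm : ℕ → ℝ) (M1 M2 M3 α : ℝ)
    (x : ℝ → (Fin n → ℝ)) (τ : ℝ → ℝ) : Prop where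
  isSol : IsIIVPSol n K f g Imp φ lam tI α x τ
  pos : ∀ t ∈ Icc 0 α, 0 < τ t
  bound : ∀ t ≤ α, ‖x t‖ + τ t ≤ M1
  lip : LipschitzOff (breakpoints K tI tm) M2 (-M1) α x
  lipDelay : ∀ t ∈ Icc 0 α, ∀ s ∈ Icc 0 α, |τ t - τ s| ≤ M3 * |t - s|
  integrable : IntervalIntegrable (fun s => g s (x s) (τ s)) volume 0 α

/-- Approximate solutions `(X j, Θ j)` with step sizes `h j → 0`, uniformly bounded and Lipschitz,
which converge pointwise to `(x, τ)`. -/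
structure IsApproximated (n K : ℕ) (f : ℝ → (Fin n → ℝ) → (Fin n → ℝ) → (Fin n → ℝ))
    (g : ℝ → (Fin n → ℝ) → ℝ → ℝ) (Imp : ℕ → (Fin n → ℝ) → (Fin n → ℝ))
    (φ : ℝ → (Fin n → ℝ)) (lam : ℝ) (tI tm : ℕ → ℝ) (M1 M2 M3 α : ℝ)
    (h : ℕ → ℝ) (X : ℕ → ℝ → (Fin n → ℝ)) (Θ : ℕ → ℝ → ℝ)
    (x : ℝ → (Fin n → ℝ)) (τ : ℝ → ℝ) : Prop where
  step_pos : ∀ j, 0 < h j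
  step_lim : Tendsto h atTop (nhds 0)
  isSol : ∀ j, IsEPCASol n K f g Imp φ lam tI (h j) α (X j) (Θ j)
  pos : ∀ j, ∀ t ∈ Icc 0 α, 0 < Θ j t
  bound : ∀ j, ∀ t ≤ α, ‖X j t‖ + Θ j t ≤ M1
  lip : ∀ j, LipschitzOff (breakpoints K tI tm) M2 (-M1) α (X j)
  lipDelay : ∀ j, ∀ t ∈ Icc 0 α, ∀ s ∈ Icc 0 α, |Θ j t - Θ j s| ≤ M3 * |t - s|
  tendsto : ∀ t ≤ α, Tendsto (fun j => X j t) atTop (nhds (x t))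
  tendstoDelay : ∀ t ≤ α, Tendsto (fun j => Θ j t) atTop (nhds (τ t))

section Limit

variable {n K : ℕ} {T : ℝ} {f : ℝ → (Fin n → ℝ) → (Fin n → ℝ) → (Fin n → ℝ)}
  {g : ℝ → (Fin n → ℝ) → ℝ → ℝ} {Imp : ℕ → (Fin n → ℝ) → (Fin n → ℝ)}
  {φ : ℝ → (Fin n → ℝ)} {lam : ℝ} {tI tm : ℕ → ℝ} {M1 M2 M3 α : ℝ}
  {h : ℕ → ℝ} {X : ℕ → ℝ → (Fin n → ℝ)} {Θ : ℕ → ℝ → ℝ}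
  {x : ℝ → (Fin n → ℝ)} {τ : ℝ → ℝ}

namespace IsApproximated

lemma eq_of_nonpos (H : IsApproximated n K f g Imp φ lam tI tm M1 M2 M3 α h X Θ x τ)
    (hα : 0 < α) {t : ℝ} (ht : t ≤ 0) : x t = φ t ∧ τ t = lam := by
  constructor
  · refine tendsto_nhds_unique (H.tendsto t (ht.trans hα.le)) ?_
    simp only [fun j => (H.isSol j).1 t ht, tendsto_const_nhds]
  · refine tendsto_nhds_unique (H.tendstoDelay t (ht.trans hα.le)) ?_
    simp only [fun j => (H.isSol j).2.1 t ht, tendsto_const_nhds]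

lemma approx_nonneg (H : IsApproximated n K f g Imp φ lam tI tm M1 M2 M3 α h X Θ x τ)
    (hlam : 0 < lam) (j : ℕ) {t : ℝ} (ht : t ≤ α) : 0 ≤ Θ j t := by
  rcases le_or_gt t 0 with h0 | h0
  · rw [(H.isSol j).2.1 t h0]; exact hlam.le
  · exact (H.pos j t ⟨h0.le, ht⟩).le

lemma norm_approx_le (H : IsApproximated n K f g Imp φ lam tI tm M1 M2 M3 α h X Θ x τ)
    (hlam : 0 < lam) (j : ℕ) {t : ℝ} (ht : t ≤ α) : ‖X j t‖ ≤ M1 := by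
  linarith [H.bound j t ht, H.approx_nonneg hlam j ht]

lemma abs_approx_le (H : IsApproximated n K f g Imp φ lam tI tm M1 M2 M3 α h X Θ x τ)
    (hlam : 0 < lam) (j : ℕ) {t : ℝ} (ht : t ≤ α) : |Θ j t| ≤ M1 := by
  rw [abs_of_nonneg (H.approx_nonneg hlam j ht)]
  linarith [H.bound j t ht, norm_nonneg (X j t)]

lemma nonneg (H : IsApproximated n K f g Imp φ lam tI tm M1 M2 M3 α h X Θ x τ)
    (hlam : 0 < lam) {t : ℝ} (ht : t ≤ α) : 0 ≤ τ t :=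
  ge_of_tendsto' (H.tendstoDelay t ht) fun j => H.approx_nonneg hlam j ht

lemma norm_add_le (H : IsApproximated n K f g Imp φ lam tI tm M1 M2 M3 α h X Θ x τ)
    {t : ℝ} (ht : t ≤ α) : ‖x t‖ + τ t ≤ M1 :=
  le_of_tendsto' ((H.tendsto t ht).norm.add (H.tendstoDelay t ht)) fun j => H.bound j t ht

lemma norm_le (H : IsApproximated n K f g Imp φ lam tI tm M1 M2 M3 α h X Θ x τ)
    (hlam : 0 < lam) {t : ℝ} (ht : t ≤ α) : ‖x t‖ ≤ M1 :=
  le_of_tendsto' (H.tendsto t ht).norm fun j => H.norm_approx_le hlam j ht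

lemma le (H : IsApproximated n K f g Imp φ lam tI tm M1 M2 M3 α h X Θ x τ)
    {t : ℝ} (ht : t ≤ α) : τ t ≤ M1 := by
  linarith [H.norm_add_le ht, norm_nonneg (x t)]

lemma lipschitzOff (H : IsApproximated n K f g Imp φ lam tI tm M1 M2 M3 α h X Θ x τ) :
    LipschitzOff (breakpoints K tI tm) M2 (-M1) α x := fun s t hs hst ht hno =>
  le_of_tendsto' ((H.tendsto t ht).sub (H.tendsto s (hst.trans ht))).norm
    fun j => H.lip j s t hs hst ht hno

lemma abs_sub_le (H : IsApproximated n K f g Imp φ lam tI tm M1 M2 M3 α h X Θ x τ) :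
    ∀ t ∈ Icc 0 α, ∀ s ∈ Icc 0 α, |τ t - τ s| ≤ M3 * |t - s| := fun t ht s hs =>
  le_of_tendsto' ((H.tendstoDelay t ht.2).sub (H.tendstoDelay s hs.2)).abs
    fun j => H.lipDelay j t ht s hs

lemma continuousOn_delay (H : IsApproximated n K f g Imp φ lam tI tm M1 M2 M3 α h X Θ x τ)
    (hM3 : 0 ≤ M3) : ContinuousOn τ (Icc 0 α) :=
  (LipschitzOnWith.of_dist_le_mul (K := ⟨M3, hM3⟩) fun t ht s hs =>
    H.abs_sub_le t ht s hs).continuousOn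

lemma tendsto_flr_delay (H : IsApproximated n K f g Imp φ lam tI tm M1 M2 M3 α h X Θ x τ)
    {s : ℝ} (hs : s ∈ Icc 0 α) :
    Tendsto (fun j => Θ j (flr (h j) s)) atTop (nhds (τ s)) := by
  have hfl : Tendsto (fun j => flr (h j) s) atTop (nhds s) :=
    tendsto_flr H.step_pos H.step_lim tendsto_const_nhds
  have h0 : Tendsto (fun j => M3 * |flr (h j) s - s|) atTop (nhds 0) := by
    have : Tendsto (fun j => M3 * |flr (h j) s - s|) atTop (nhds (M3 * |s - s|)) :=
      ((hfl.sub_const s).abs).const_mul M3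
    simpa using this
  have hz : Tendsto (fun j => Θ j (flr (h j) s) - Θ j s) atTop (nhds 0) :=
    squeeze_zero_norm (fun j => H.lipDelay j _ ⟨flr_nonneg (H.step_pos j) hs.1,
      (flr_le (H.step_pos j) s).trans hs.2⟩ s hs) h0
  simpa using hz.add (H.tendstoDelay s hs.2)

lemma tendsto_flr_state (H : IsApproximated n K f g Imp φ lam tI tm M1 M2 M3 α h X Θ x τ)
    (htm : Tendsto tm atTop atBot) (hM1 : 0 < M1) {s : ℝ} (hs : s ∈ Icc 0 α)
    (hsB : s ∉ breakpoints K tI tm) :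
    Tendsto (fun j => X j (flr (h j) s)) atTop (nhds (x s)) :=
  LipschitzOff.tendsto_comp (finite_breakpoints_inter_Ici K tI htm) H.lip
    (by linarith [hs.1]) hs.2 hsB (H.tendsto s hs.2)
    (tendsto_flr H.step_pos H.step_lim tendsto_const_nhds)
    fun j => (flr_le (H.step_pos j) s).trans hs.2

lemma tendsto_delayRate (H : IsApproximated n K f g Imp φ lam tI tm M1 M2 M3 α h X Θ x τ)
    (hg : AssumptionA2 n T g) (hαT : α ≤ T) (htm : Tendsto tm atTop atBot) (hM1 : 0 < M1)
    {s : ℝ} (hs : s ∈ Icc 0 α) (hsB : s ∉ breakpoints K tI tm) :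
    Tendsto (fun j => g (flr (h j) s) (X j (flr (h j) s)) (Θ j (flr (h j) s))) atTop
      (nhds (g s (x s) (τ s))) :=
  hg.tendsto ⟨hs.1, hs.2.trans hαT⟩
    (Eventually.of_forall fun j => ⟨flr_nonneg (H.step_pos j) hs.1,
      (flr_le (H.step_pos j) s).trans (hs.2.trans hαT)⟩)
    (tendsto_flr H.step_pos H.step_lim tendsto_const_nhds)
    (H.tendsto_flr_state htm hM1 hs hsB) (H.tendsto_flr_delay hs)

lemma intervalIntegrable_delayRate
    (H : IsApproximated n K f g Imp φ lam tI tm M1 M2 M3 α h X Θ x τ)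
    (hg : AssumptionA2 n T g) (hlam : 0 < lam) (hα : 0 < α) (hαT : α ≤ T)
    (htm : Tendsto tm atTop atBot) (hM1 : 0 < M1) :
    IntervalIntegrable (fun s => g s (x s) (τ s)) volume 0 α := by
  obtain ⟨C, -, hC⟩ := hg.exists_bound M1
  rw [intervalIntegrable_iff, uIoc_of_le hα.le]
  refine IntegrableOn.of_bound measure_Ioc_lt_top ?_ C ?_
  · refine aestronglyMeasurable_of_tendsto_ae atTop
      (f := fun j s => g (flr (h j) s) (X j (flr (h j) s)) (Θ j (flr (h j) s)))
      (fun j => (measurable_comp_flr (h j)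
        fun r => g r (X j r) (Θ j r)).aestronglyMeasurable) ?_
    filter_upwards [ae_restrict_mem measurableSet_Ioc,
      (countable_breakpoints K tI tm).ae_notMem _] with s hs hsB
    exact H.tendsto_delayRate hg hαT htm hM1 ⟨hs.1.le, hs.2⟩ hsB
  · filter_upwards [ae_restrict_mem measurableSet_Ioc] with s hs
    exact hC s ⟨hs.1.le, hs.2.trans hαT⟩ _ _ (H.norm_le hlam hs.2)
      (by rw [abs_of_nonneg (H.nonneg hlam hs.2)]; exact H.le hs.2)

lemma delay_eq (H : IsApproximated n K f g Imp φ lam tI tm M1 M2 M3 α h X Θ x τ)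
    (hg : AssumptionA2 n T g) (hlam : 0 < lam) (hαT : α ≤ T)
    (htm : Tendsto tm atTop atBot) (hM1 : 0 < M1) :
    ∀ t ∈ Icc 0 α, τ t = lam + ∫ s in (0 : ℝ)..t, g s (x s) (τ s) := by
  intro t ht
  obtain ⟨C, -, hC⟩ := hg.exists_bound M1
  refine tendsto_nhds_unique (H.tendstoDelay t ht.2) ?_
  simp only [fun j => (H.isSol j).2.2.2.1 t ht]
  refine (intervalIntegral.tendsto_integral_filter_of_dominated_convergence (fun _ => C)
    (Eventually.of_forall fun j => (measurable_comp_flr (h j)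
        fun r => g r (X j r) (Θ j r)).aestronglyMeasurable)
    (Eventually.of_forall fun j => Eventually.of_forall fun s hs => ?_)
    intervalIntegrable_const ?_).const_add lam
  · rw [uIoc_of_le ht.1] at hs
    have hle := (flr_le (H.step_pos j) s).trans (hs.2.trans ht.2)
    exact hC _ ⟨flr_nonneg (H.step_pos j) hs.1.le, hle.trans hαT⟩ _ _
      (H.norm_approx_le hlam j hle) (H.abs_approx_le hlam j hle)
  · filter_upwards [(countable_breakpoints K tI tm).ae_notMem _] with s hsB hs
    rw [uIoc_of_le ht.1] at hs
    exact H.tendsto_delayRate hg hαT htm hM1 ⟨hs.1.le, hs.2.trans ht.2⟩ hsB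

lemma tendsto_stateRate (H : IsApproximated n K f g Imp φ lam tI tm M1 M2 M3 α h X Θ x τ)
    (hf : AssumptionA1 n T f) (hlam : 0 < lam) (hαT : α ≤ T)
    (htm : Tendsto tm atTop atBot) (hM1 : 0 < M1)
    {s : ℝ} (hs : s ∈ Icc 0 α) (hsB : s ∉ breakpoints K tI tm)
    (hlow : -M1 < s - τ s) (hsB' : s - τ s ∉ breakpoints K tI tm) :
    Tendsto (fun j => f (flr (h j) s) (X j (flr (h j) s))
      (X j (flr (h j) s - flr (h j) (Θ j (flr (h j) s))))) atTop
      (nhds (f s (x s) (x (s - τ s)))) := by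
  have hfl : Tendsto (fun j => flr (h j) s) atTop (nhds s) :=
    tendsto_flr H.step_pos H.step_lim tendsto_const_nhds
  have hsα : s - τ s ≤ α := by linarith [hs.2, H.nonneg hlam hs.2]
  have hle : ∀ j, flr (h j) s ≤ α := fun j => (flr_le (H.step_pos j) s).trans hs.2
  refine hf.tendsto ⟨hs.1, hs.2.trans hαT⟩
    (Eventually.of_forall fun j => ⟨flr_nonneg (H.step_pos j) hs.1, (hle j).trans hαT⟩)
    hfl (H.tendsto_flr_state htm hM1 hs hsB) ?_
  refine LipschitzOff.tendsto_comp (finite_breakpoints_inter_Ici K tI htm) H.lip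
    hlow hsα hsB' (H.tendsto _ hsα)
    (hfl.sub (tendsto_flr H.step_pos H.step_lim (H.tendsto_flr_delay hs))) fun j => ?_
  linarith [hle j, flr_nonneg (H.step_pos j) (H.approx_nonneg hlam j (hle j))]

lemma state_eq (H : IsApproximated n K f g Imp φ lam tI tm M1 M2 M3 α h X Θ x τ)
    (hf : AssumptionA1 n T f) (hlam : 0 < lam) (hlamM : lam < M1) (hαT : α ≤ T)
    (htm : Tendsto tm atTop atBot) (hτ0 : τ 0 = lam)
    (hmono : StrictMonoOn (fun t => t - τ t) (Icc 0 α)) {a b : ℝ} (ha : 0 ≤ a) (hab : a ≤ b)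
    (hb : b ≤ α) (hno : ∀ k, 1 ≤ k → k ≤ K → tI k ∉ Ioc a b) :
    x b = x a + ∫ s in a..b, f s (x s) (x (s - τ s)) := by
  have hM1 : 0 < M1 := hlam.trans hlamM
  obtain ⟨C, -, hC⟩ := hf.exists_bound M1
  have hcount : {s | s ∈ Icc 0 α ∧ s - τ s ∈ breakpoints K tI tm}.Countable :=
    countable_of_injective_of_countable_image
      (hmono.injOn.mono fun s hs => hs.1)
      ((countable_breakpoints K tI tm).mono (image_subset_iff.2 fun s hs => hs.2))
  refine tendsto_nhds_unique (H.tendsto b hb) ?_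
  simp only [fun j => (H.isSol j).2.2.2.2.2.2 a b ha hab hb hno]
  refine (H.tendsto a (hab.trans hb)).add
    (intervalIntegral.tendsto_integral_filter_of_dominated_convergence (fun _ => C)
    (Eventually.of_forall fun j => (measurable_comp_flr (h j)
        fun r => f r (X j r) (X j (r - flr (h j) (Θ j r)))).aestronglyMeasurable)
    (Eventually.of_forall fun j => Eventually.of_forall fun s hs => ?_)
    intervalIntegrable_const ?_)
  · rw [uIoc_of_le hab] at hs
    have hle := (flr_le (H.step_pos j) s).trans (hs.2.trans hb)
    have h0 := flr_nonneg (H.step_pos j) (H.approx_nonneg hlam j hle)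
    exact hC _ ⟨flr_nonneg (H.step_pos j) (by linarith [hs.1]), hle.trans hαT⟩ _ _
      (H.norm_approx_le hlam j hle) (H.norm_approx_le hlam j (by linarith))
  · filter_upwards [(countable_breakpoints K tI tm).ae_notMem _, hcount.ae_notMem _]
      with s hsB hsB' hs
    rw [uIoc_of_le hab] at hs
    have hsI : s ∈ Icc 0 α := ⟨by linarith [hs.1], hs.2.trans hb⟩
    have hle : 0 - τ 0 ≤ s - τ s := hmono.monotoneOn ⟨le_rfl, hsI.1.trans hsI.2⟩ hsI hsI.1
    exact H.tendsto_stateRate hf hlam hαT htm hM1 hsI hsB (by linarith)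
      fun hmem => hsB' ⟨hsI, hmem⟩

/-- The jump conditions pass to the limit. -/
lemma jump (H : IsApproximated n K f g Imp φ lam tI tm M1 M2 M3 α h X Θ x τ)
    (hImp : AssumptionA3 n K Imp) (htm : Tendsto tm atTop atBot) (hM1 : 0 < M1) (hM2 : 0 ≤ M2)
    {k : ℕ} (hk1 : 1 ≤ k) (hkK : k ≤ K) (hpos : 0 < tI k) (hkα : tI k ≤ α) :
    ∃ ξ, Tendsto x (nhdsWithin (tI k) (Iio (tI k))) (nhds ξ) ∧ x (tI k) = ξ + Imp k ξ := by
  obtain ⟨δ, hδ, hgap⟩ := exists_gap (finite_breakpoints_inter_Ici K tI htm) (tI k)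
  have hlt : max 0 (tI k - δ) < tI k := max_lt hpos (by linarith)
  have hno : ∀ s ∈ Ioo (max 0 (tI k - δ)) (tI k), ∀ t < tI k, ∀ b ∈ breakpoints K tI tm,
      b ∉ Ioc s t := fun s hs t ht b hb hbI => by
    have h1 := (le_max_right _ _).trans_lt hs.1
    have := hgap b hb ⟨by linarith [hbI.1], by linarith [hbI.2]⟩
    linarith [hbI.2]
  choose ξ hξ hjump using fun j => (H.isSol j).2.2.2.2.2.1 k hk1 hkK hkα
  have hξX : ∀ s ∈ Ioo (max 0 (tI k - δ)) (tI k), ∀ j,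
      ‖ξ j - X j s‖ ≤ M2 * (tI k - s) := by
    intro s hs j
    refine le_of_tendsto ((hξ j).sub_const (X j s)).norm ?_
    filter_upwards [Ioo_mem_nhdsLT hs.2] with t ht
    have h0 := (le_max_left _ _).trans_lt hs.1
    refine (H.lip j s t (by linarith) ht.1.le (ht.2.le.trans hkα) (hno s hs t ht.2)).trans ?_
    exact mul_le_mul_of_nonneg_left (by linarith [ht.2]) hM2
  obtain ⟨l, hl⟩ : ∃ l, Tendsto ξ atTop (nhds l) := by
    refine exists_tendsto_of_approx fun ε hε => ?_
    obtain ⟨s, hs1, hs2⟩ := exists_between (show max (max 0 (tI k - δ)) (tI k - ε / (M2 + 1))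
      < tI k from max_lt hlt (by have : 0 < ε / (M2 + 1) := by positivity
                                 linarith))
    have hs3 := (le_max_right _ _).trans_lt hs1
    refine ⟨fun j => X j s, ⟨_, H.tendsto s (hs2.le.trans hkα)⟩, fun j =>
      (hξX s ⟨(le_max_left _ _).trans_lt hs1, hs2⟩ j).trans ?_⟩
    calc M2 * (tI k - s) ≤ (M2 + 1) * (ε / (M2 + 1)) := by
          apply mul_le_mul <;> linarith
      _ = ε := by field_simp
  have hlx : ∀ s ∈ Ioo (max 0 (tI k - δ)) (tI k), ‖x s - l‖ ≤ M2 * (tI k - s) := by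
    intro s hs
    rw [norm_sub_rev]
    exact le_of_tendsto' (hl.sub (H.tendsto s (hs.2.le.trans hkα))).norm fun j => hξX s hs j
  refine ⟨l, ?_, ?_⟩
  · have h0 : Tendsto (fun s => M2 * (tI k - s)) (nhdsWithin (tI k) (Iio (tI k))) (nhds 0) := by
      have : Continuous fun s => M2 * (tI k - s) := by fun_prop
      simpa using (this.tendsto (tI k)).mono_left nhdsWithin_le_nhds
    refine tendsto_sub_nhds_zero_iff.1 (squeeze_zero_norm' ?_ h0)
    filter_upwards [Ioo_mem_nhdsLT hlt] with s hs using hlx s hs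
  · obtain ⟨L, hL, hLip⟩ := hImp
    have hcont : Continuous (Imp k) := (LipschitzWith.of_dist_le_mul (K := ⟨L, hL⟩) fun u v => by
      rw [dist_eq_norm, dist_eq_norm]; exact hLip k hk1 hkK u v).continuous
    refine tendsto_nhds_unique (H.tendsto _ hkα) ?_
    simp only [hjump]
    exact hl.add ((hcont.tendsto l).comp hl)

/-- Limits of approximate solutions are solutions. -/
theorem isRegularSol (H : IsApproximated n K f g Imp φ lam tI tm M1 M2 M3 α h X Θ x τ)
    (hf : AssumptionA1 n T f) (hg : AssumptionA2 n T g) (hImp : AssumptionA3 n K Imp)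
    (htm : Tendsto tm atTop atBot) (htI : ∀ k, 1 ≤ k → k ≤ K → 0 < tI k)
    (hlam : 0 < lam) (hlamM : lam < M1) (hα : 0 < α) (hαT : α ≤ T)
    (hM2 : 0 ≤ M2) (hM3 : 0 ≤ M3) (hxα : ∀ t, α ≤ t → x t = x α)
    (hg1 : ∀ t ∈ Icc 0 α, ∀ u, ‖u‖ ≤ M1 → ∀ w ∈ Icc 0 M1, g t u w < 1) :
    IsRegularSol n K f g Imp φ lam tI tm M1 M2 M3 α x τ := by
  have hM1 : 0 < M1 := hlam.trans hlamM
  have hint := H.intervalIntegrable_delayRate hg hlam hα hαT htm hM1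
  have heq := H.delay_eq hg hlam hαT htm hM1
  have hmono := strictMonoOn_sub_delay hint (fun t ht => hg1 t ht _ (H.norm_le hlam ht.2) _
    ⟨H.nonneg hlam ht.2, H.le ht.2⟩) heq
  refine ⟨⟨fun t ht => (H.eq_of_nonpos hα ht).1, fun t ht => (H.eq_of_nonpos hα ht).2,
    H.continuousOn_delay hM3, heq, fun t ht => ?_, fun k hk1 hkK hkα =>
      H.jump hImp htm hM1 hM2 hk1 hkK (htI k hk1 hkK) hkα,
    fun a b ha hab hb hno => H.state_eq hf hlam hlamM hαT htm (H.eq_of_nonpos hα le_rfl).2 hmono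
      ha hab hb hno⟩,
    hg.pos_of_integral_eq hαT hlam (H.continuousOn_delay hM3)
      (fun t ht => H.nonneg hlam ht.2) (fun t ht => H.norm_le hlam ht.2) hint heq,
    fun t ht => H.norm_add_le ht, H.lipschitzOff, H.abs_sub_le, hint⟩
  rcases eq_or_lt_of_le ht.2 with rfl | hlt
  · exact tendsto_const_nhds.congr' (eventually_nhdsWithin_of_forall fun s hs => (hxα s hs).symm)
  obtain ⟨δ, hδ, hgap⟩ := exists_gap (finite_breakpoints_inter_Ici K tI htm) t
  have h0 : Tendsto (fun s => M2 * (s - t)) (nhdsWithin t (Ici t)) (nhds 0) := by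
    have : Continuous fun s => M2 * (s - t) := by fun_prop
    simpa using (this.tendsto t).mono_left nhdsWithin_le_nhds
  refine tendsto_sub_nhds_zero_iff.1 (squeeze_zero_norm' ?_ h0)
  filter_upwards [Ico_mem_nhdsGE (lt_min hlt (lt_add_of_pos_right t hδ))] with s hs
  have hs2 := lt_min_iff.1 hs.2
  refine H.lipschitzOff t s (by linarith [ht.1]) hs.1 hs2.1.le fun b hb hbI => ?_
  have := hgap b hb ⟨by linarith [hbI.1], by linarith [hbI.2]⟩
  linarith [hbI.1]

end IsApproximated

end Limit

section Uniqueness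

variable {n K : ℕ} {T : ℝ} {f : ℝ → (Fin n → ℝ) → (Fin n → ℝ) → (Fin n → ℝ)}
  {g : ℝ → (Fin n → ℝ) → ℝ → ℝ} {Imp : ℕ → (Fin n → ℝ) → (Fin n → ℝ)}
  {φ : ℝ → (Fin n → ℝ)} {lam : ℝ} {tI tm : ℕ → ℝ} {M1 M2 M3 α : ℝ}
  {x y : ℝ → (Fin n → ℝ)} {τ θ : ℝ → ℝ}

/-- The state of a solution is continuous for a short time after any `a < α`. -/
lemma IsIIVPSol.exists_continuousOn (Y : IsIIVPSol n K f g Imp φ lam tI α y θ)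
    (htm : Tendsto tm atTop atBot) {a : ℝ} (ha : 0 ≤ a) (haα : a < α) :
    ∃ b > a, b ≤ α ∧ (∀ k, 1 ≤ k → k ≤ K → tI k ∉ Ioc a b) ∧ ContinuousOn y (Icc a b) := by
  obtain ⟨δ, hδ, hgap⟩ := exists_gap (finite_breakpoints_inter_Ici K tI htm) a
  have hb : a < min α (a + δ) := lt_min haα (by linarith)
  have hno : ∀ k, 1 ≤ k → k ≤ K → tI k ∉ Ioc a (min α (a + δ)) := fun k h1 h2 hk => by
    have := hgap _ (Or.inl ⟨k, ⟨h1, h2⟩, rfl⟩)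
      ⟨by linarith [hk.1], hk.2.trans (min_le_right _ _)⟩
    linarith [hk.1]
  generalize min α (a + δ) = b₀ at hb hno
  have hbα : min b₀ α ≤ α := min_le_right _ _
  have hb' : a < min b₀ α := lt_min hb haα
  have heq : ∀ s ∈ Icc a (min b₀ α), y s = y a + ∫ r in a..s, f r (y r) (y (r - θ r)) :=
    fun s hs => Y.2.2.2.2.2.2 a s ha hs.1 (hs.2.trans hbα) fun k h1 h2 hk =>
      hno k h1 h2 ⟨hk.1, hk.2.trans (hs.2.trans (min_le_left _ _))⟩
  have hno' : ∀ b ≤ min b₀ α, ∀ k, 1 ≤ k → k ≤ K → tI k ∉ Ioc a b := fun b hb k h1 h2 hk =>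
    hno k h1 h2 ⟨hk.1, hk.2.trans (hb.trans (min_le_left _ _))⟩
  by_cases hI : ∃ b ∈ Ioc a (min b₀ α),
      IntervalIntegrable (fun r => f r (y r) (y (r - θ r))) volume a b
  · obtain ⟨b, hb, hI⟩ := hI
    refine ⟨b, hb.1, hb.2.trans hbα, hno' b hb.2, ?_⟩
    have := intervalIntegral.continuousOn_primitive_interval' hI left_mem_uIcc
    rw [uIcc_of_le hb.1.le] at this
    exact (continuousOn_const.add this).congr fun s hs => heq s ⟨hs.1, hs.2.trans hb.2⟩
  · refine ⟨min b₀ α, hb', hbα, hno' _ le_rfl, ?_⟩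
    refine (continuousOn_const (c := y a)).congr fun s hs => ?_
    rcases eq_or_lt_of_le hs.1 with rfl | h
    · rfl
    · rw [heq s hs, intervalIntegral.integral_undef fun h' => hI ⟨s, ⟨h, hs.2⟩, h'⟩, add_zero]

/-- Short-time description, after a time `a`, of any solution that agrees up to time `a` with a
regular one: the delayed state is read off from a single smooth piece of the regular solution. -/
lemma IsRegularSol.exists_forward (R : IsRegularSol n K f g Imp φ lam tI tm M1 M2 M3 α x τ)
    (Y : IsIIVPSol n K f g Imp φ lam tI α y θ)
    (hf : AssumptionA1 n T f) (hg : AssumptionA2 n T g) (hαT : α ≤ T)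
    (htm : Tendsto tm atTop atBot)
    (hg1 : ∀ t ∈ Icc 0 α, ∀ u, ‖u‖ ≤ M1 → ∀ w ∈ Icc 0 M1, g t u w < 1)
    {a : ℝ} (ha : 0 ≤ a) (haα : a < α) (hagree : ∀ t ≤ a, y t = x t ∧ θ t = τ t)
    {σ : ℝ} (hσ : a - τ a < σ) (hσa : σ ≤ a) (hxσ : ContinuousOn x (Icc (a - τ a) σ)) :
    ∃ b > a, b ≤ α ∧ ContinuousOn y (Icc a b) ∧
      ContinuousOn (fun s => f s (y s) (x (s - θ s))) (Icc a b) ∧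
      ContinuousOn (fun s => g s (y s) (θ s)) (Icc a b) ∧
      ∀ s ∈ Icc a b, ‖y s‖ ≤ M1 + 1 ∧ |θ s| ≤ M1 + 1 ∧ s - θ s ∈ Icc (a - τ a) σ ∧
        y s = x a + (∫ r in a..s, f r (y r) (x (r - θ r))) ∧
        θ s = τ a + ∫ r in a..s, g r (y r) (θ r) := by
  obtain ⟨b₀, hab₀, hb₀α, hno, hyc⟩ := Y.exists_continuousOn htm ha haα
  have haI : a ∈ Icc a b₀ := ⟨le_rfl, hab₀.le⟩
  have hθc : ContinuousOn θ (Icc a b₀) := Y.2.2.1.mono (Icc_subset_Icc ha hb₀α)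
  have hIT : ∀ s ∈ Icc a b₀, s ∈ Icc 0 T := fun s hs =>
    ⟨ha.trans hs.1, hs.2.trans (hb₀α.trans hαT)⟩
  have hGc : ContinuousOn (fun s => g s (y s) (θ s)) (Icc a b₀) :=
    hg.1.comp (f := fun s => (s, y s, θ s)) (continuousOn_id.prodMk (hyc.prodMk hθc))
      fun s hs => ⟨hIT s hs, mem_univ _, mem_univ _⟩
  obtain ⟨hya, hθa⟩ := hagree a le_rfl
  have hτa := R.pos a ⟨ha, haα.le⟩
  have hba := R.bound a haα.le
  have hxa := norm_nonneg (x a)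
  have e1 : ∀ᶠ s in nhdsWithin a (Icc a b₀), ‖y s‖ < M1 + 1 :=
    (hyc a haI).norm.eventually (gt_mem_nhds (by show ‖y a‖ < M1 + 1; rw [hya]; linarith))
  have e2 : ∀ᶠ s in nhdsWithin a (Icc a b₀), |θ s| < M1 + 1 :=
    (hθc a haI).abs.eventually (gt_mem_nhds (by show |θ a| < M1 + 1; rw [hθa, abs_of_pos hτa]; linarith))
  have e3 : ∀ᶠ s in nhdsWithin a (Icc a b₀), s - θ s < σ :=
    (continuousWithinAt_id.sub (hθc a haI)).eventually
      (gt_mem_nhds (by show a - θ a < σ; rw [hθa]; exact hσ))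
  have e4 : ∀ᶠ s in nhdsWithin a (Icc a b₀), g s (y s) (θ s) < 1 :=
    (hGc a haI).eventually (gt_mem_nhds (by
      show g a (y a) (θ a) < 1
      rw [hya, hθa]
      exact hg1 a ⟨ha, haα.le⟩ _ (by linarith) _ ⟨hτa.le, by linarith⟩))
  obtain ⟨b₁, hab₁, hsub⟩ := (mem_nhdsGE_iff_exists_Icc_subset).1
    (nhdsWithin_Icc_eq_nhdsGE hab₀ ▸ (e1.and (e2.and (e3.and e4))))
  have hb0 := min_le_left b₀ b₁
  have hb1 := min_le_right b₀ b₁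
  have hab : a < min b₀ b₁ := lt_min hab₀ hab₁
  generalize min b₀ b₁ = b at hb0 hb1 hab
  have hsubI : Icc a b ⊆ Icc a b₀ := Icc_subset_Icc le_rfl hb0
  have hGI : ∀ s ∈ Icc a b, IntervalIntegrable (fun s => g s (y s) (θ s)) volume a s :=
    fun s hs => (hGc.mono (Icc_subset_Icc le_rfl (hs.2.trans hb0))).intervalIntegrable_of_Icc hs.1
  have hG0 : IntervalIntegrable (fun s => g s (y s) (θ s)) volume 0 a := by
    refine (R.integrable.mono_set ?_).congr fun s hs => ?_
    · rw [uIcc_of_le ha, uIcc_of_le (ha.trans haα.le)]; exact Icc_subset_Icc le_rfl haα.le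
    · rw [uIoc_of_le ha] at hs
      simp only [(hagree s hs.2).1, (hagree s hs.2).2]
  have hθeq : ∀ s ∈ Icc a b, θ s = τ a + ∫ r in a..s, g r (y r) (θ r) := by
    intro s hs
    rw [← hθa, Y.2.2.2.1 s ⟨ha.trans hs.1, (hs.2.trans hb0).trans hb₀α⟩,
      Y.2.2.2.1 a ⟨ha, haα.le⟩, add_assoc,
      intervalIntegral.integral_add_adjacent_intervals hG0 (hGI s hs)]
  have hdelay : ∀ s ∈ Icc a b, s - θ s ∈ Icc (a - τ a) σ := by
    intro s hs
    have hle : ∫ r in a..s, g r (y r) (θ r) ≤ ∫ _ in a..s, (1 : ℝ) :=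
      intervalIntegral.integral_mono_on hs.1 (hGI s hs) intervalIntegrable_const fun r hr =>
        (hsub ⟨hr.1, hr.2.trans (hs.2.trans hb1)⟩).2.2.2.le
    rw [intervalIntegral.integral_const, smul_eq_mul, mul_one] at hle
    exact ⟨by linarith [hθeq s hs], (hsub ⟨hs.1, hs.2.trans hb1⟩).2.2.1.le⟩
  have hθc' := hθc.mono hsubI
  refine ⟨b, hab, hb0.trans hb₀α, hyc.mono hsubI, ?_, hGc.mono hsubI, fun s hs => ?_⟩
  · exact hf.1.comp (f := fun s => (s, y s, x (s - θ s)))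
      (continuousOn_id.prodMk ((hyc.mono hsubI).prodMk
        (hxσ.comp (continuousOn_id.sub hθc') hdelay)))
      fun s hs => ⟨hIT s (hsubI hs), mem_univ _, mem_univ _⟩
  · obtain ⟨h1, h2, -, -⟩ := hsub ⟨hs.1, hs.2.trans hb1⟩
    refine ⟨h1.le, h2.le, hdelay s hs, ?_, hθeq s hs⟩
    rw [← hya, Y.2.2.2.2.2.2 a s ha hs.1 ((hs.2.trans hb0).trans hb₀α) fun k h1 h2 hk =>
      hno k h1 h2 ⟨hk.1, hk.2.trans (hs.2.trans hb0)⟩]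
    congr 1
    refine intervalIntegral.integral_congr fun r hr => ?_
    rw [uIcc_of_le hs.1] at hr
    have := (hdelay r ⟨hr.1, hr.2.trans hs.2⟩).2
    simp only [(hagree (r - θ r) (by linarith)).1]

/-- Agreement with a regular solution extends a little to the right. -/
lemma IsRegularSol.exists_agree_right (R : IsRegularSol n K f g Imp φ lam tI tm M1 M2 M3 α x τ)
    (Y : IsIIVPSol n K f g Imp φ lam tI α y θ)
    (hf : AssumptionA1 n T f) (hg : AssumptionA2 n T g) (hαT : α ≤ T)
    (htm : Tendsto tm atTop atBot) (hlamM : lam ≤ M1) (hM1 : 0 ≤ M1) (hM2 : 0 ≤ M2)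
    (hg1 : ∀ t ∈ Icc 0 α, ∀ u, ‖u‖ ≤ M1 → ∀ w ∈ Icc 0 M1, g t u w < 1)
    {a : ℝ} (ha : 0 ≤ a) (haα : a < α) (hagree : ∀ t ≤ a, y t = x t ∧ θ t = τ t) :
    ∃ b > a, b ≤ α ∧ ∀ t ≤ b, y t = x t ∧ θ t = τ t := by
  have hτa := R.pos a ⟨ha, haα.le⟩
  have hσ₀ : -M1 ≤ a - τ a := by
    have hmono := (strictMonoOn_sub_delay R.integrable (fun t ht => hg1 t ht _
      (by linarith [R.pos t ht, R.bound t ht.2]) _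
      ⟨(R.pos t ht).le, by linarith [norm_nonneg (x t), R.bound t ht.2]⟩)
      R.isSol.2.2.2.1).monotoneOn
    have h1 : 0 - τ 0 ≤ a - τ a := hmono ⟨le_rfl, ha.trans haα.le⟩ ⟨ha, haα.le⟩ ha
    rw [R.isSol.2.1 0 le_rfl] at h1
    linarith
  obtain ⟨δ, hδ, hgap⟩ := exists_gap (finite_breakpoints_inter_Ici K tI htm) (a - τ a)
  obtain ⟨σ, hσ, hσa, hσδ⟩ : ∃ σ, a - τ a < σ ∧ σ ≤ a ∧ σ ≤ a - τ a + δ :=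
    ⟨min a (a - τ a + δ), lt_min (by linarith) (by linarith), min_le_left _ _, min_le_right _ _⟩
  have hxLip : ∀ s ∈ Icc (a - τ a) σ, ∀ t ∈ Icc (a - τ a) σ, ‖x t - x s‖ ≤ M2 * |t - s| := by
    have key : ∀ s ∈ Icc (a - τ a) σ, ∀ t ∈ Icc (a - τ a) σ, s ≤ t →
        ‖x t - x s‖ ≤ M2 * (t - s) := fun s hs t ht hst =>
      R.lip s t (hσ₀.trans hs.1) hst (by linarith [ht.2]) fun b hb hbI => by
        have := hgap b hb ⟨by linarith [hbI.1, hs.1], by linarith [hbI.2, ht.2]⟩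
        linarith [hbI.1, hs.1]
    intro s hs t ht
    rcases le_total s t with h | h
    · rw [abs_of_nonneg (by linarith)]; exact key s hs t ht h
    · rw [norm_sub_rev, abs_sub_comm, abs_of_nonneg (by linarith)]; exact key t ht s hs h
  have hxσ : ContinuousOn x (Icc (a - τ a) σ) :=
    (LipschitzOnWith.of_dist_le_mul (K := ⟨M2, hM2⟩) fun t ht s hs => by
      rw [dist_eq_norm, Real.dist_eq]; exact hxLip s hs t ht).continuousOn
  obtain ⟨b₁, hab₁, hb₁α, hyc, hFy, hGy, hy⟩ :=
    R.exists_forward Y hf hg hαT htm hg1 ha haα hagree hσ hσa hxσ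
  obtain ⟨b₂, hab₂, hb₂α, hxc, hFx, hGx, hx⟩ :=
    R.exists_forward R.isSol hf hg hαT htm hg1 ha haα (fun t _ => ⟨rfl, rfl⟩) hσ hσa hxσ
  obtain ⟨L₁, hL₁, hfL⟩ := hf.2 (M1 + 1) (by linarith)
  obtain ⟨L₂, hL₂, hgL⟩ := hg.2.2 (M1 + 1) (by linarith)
  obtain ⟨C, hC⟩ : ∃ C, C = L₁ * (1 + M2) + L₂ := ⟨_, rfl⟩
  have hC0 : 0 ≤ C := by rw [hC]; positivity
  obtain ⟨b, hab, hb1, hb2, hbC⟩ : ∃ b, a < b ∧ b ≤ b₁ ∧ b ≤ b₂ ∧ b ≤ a + 1 / (C + 1) := by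
    refine ⟨min b₁ (min b₂ (a + 1 / (C + 1))), ?_, min_le_left _ _,
      (min_le_right _ _).trans (min_le_left _ _), (min_le_right _ _).trans (min_le_right _ _)⟩
    have : 0 < 1 / (C + 1) := by positivity
    exact lt_min hab₁ (lt_min hab₂ (by linarith))
  have hCb : C * (b - a) < 1 := by
    have h1 : C * (b - a) ≤ C * (1 / (C + 1)) :=
      mul_le_mul_of_nonneg_left (by linarith) hC0
    have h2 : C * (1 / (C + 1)) < 1 := by
      rw [mul_one_div, div_lt_one (by linarith)]; linarith
    linarith
  have hs1 : Icc a b ⊆ Icc a b₁ := Icc_subset_Icc le_rfl hb1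
  have hs2 : Icc a b ⊆ Icc a b₂ := Icc_subset_Icc le_rfl hb2
  have hIα : ∀ s ∈ Icc a b, s ∈ Icc 0 α := fun s hs => ⟨ha.trans hs.1, (hs2 hs).2.trans hb₂α⟩
  have hIα' : Icc a b ⊆ Icc 0 α := hIα
  have hDc : ContinuousOn (fun s => ‖y s - x s‖ + |θ s - τ s|) (Icc a b) :=
    ((hyc.mono hs1).sub (hxc.mono hs2)).norm.add
      ((Y.2.2.1.mono hIα').sub (R.isSol.2.2.1.mono hIα')).abs
  obtain ⟨p, hp, hmax⟩ := isCompact_Icc.exists_isMaxOn (nonempty_Icc.2 hab.le) hDc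
  obtain ⟨S, hS⟩ : ∃ S, S = ‖y p - x p‖ + |θ p - τ p| := ⟨_, rfl⟩
  have hDS : ∀ s ∈ Icc a b, ‖y s - x s‖ + |θ s - τ s| ≤ S := fun s hs => hS ▸ hmax hs
  have hS0 : 0 ≤ S := by rw [hS]; positivity
  have hI : ∀ {E : Type} [NormedAddCommGroup E] {F : ℝ → E} {b' : ℝ}, ContinuousOn F (Icc a b') →
      b ≤ b' → IntervalIntegrable F volume a p := fun hF hb' =>
    (hF.mono (Icc_subset_Icc le_rfl (hp.2.trans hb'))).intervalIntegrable_of_Icc hp.1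
  have hpa : |p - a| = p - a := abs_of_nonneg (by linarith [hp.1])
  have hpT : ∀ s ∈ uIoc a p, s ∈ Icc a b := fun s hs => by
    rw [uIoc_of_le hp.1] at hs; exact ⟨hs.1.le, hs.2.trans hp.2⟩
  have hY : ‖y p - x p‖ ≤ L₁ * (1 + M2) * S * (p - a) := by
    rw [(hy p (hs1 hp)).2.2.2.1, (hx p (hs2 hp)).2.2.2.1, add_sub_add_left_eq_sub,
      ← intervalIntegral.integral_sub (hI hFy hb1) (hI hFx hb2), ← hpa]
    refine intervalIntegral.norm_integral_le_of_norm_le_const fun s hs => ?_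
    have hs := hpT s hs
    obtain ⟨hy1, hy2, hy3, -, -⟩ := hy s (hs1 hs)
    obtain ⟨hx1, hx2, hx3, -, -⟩ := hx s (hs2 hs)
    have hxb : ∀ r ∈ Icc (a - τ a) σ, ‖x r‖ ≤ M1 + 1 := by
      intro r hr
      have hrα : r ≤ α := by linarith [hr.2]
      rcases le_or_gt r 0 with h0 | h0
      · have h1 := R.bound r hrα
        have h2 := R.pos 0 ⟨le_rfl, ha.trans haα.le⟩
        rw [R.isSol.2.1 0 le_rfl] at h2
        rw [R.isSol.2.1 r h0] at h1
        linarith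
      · linarith [R.bound r hrα, R.pos r ⟨h0.le, hrα⟩]
    have h1 := hfL s ⟨(hIα s hs).1, (hIα s hs).2.trans hαT⟩ (y s) (x s) (x (s - θ s))
      (x (s - τ s)) hy1 hx1 (hxb _ hy3) (hxb _ hx3)
    have h2 := hxLip _ hx3 _ hy3
    have h3 : |s - θ s - (s - τ s)| = |θ s - τ s| := by
      rw [abs_sub_comm]; congr 1; ring
    rw [h3] at h2
    have h4 := hDS s hs
    have h5 := norm_nonneg (y s - x s)
    have h6 := abs_nonneg (θ s - τ s)
    calc _ ≤ _ := h1
      _ ≤ L₁ * (S + M2 * S) := by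
        refine mul_le_mul_of_nonneg_left (add_le_add (by linarith) (h2.trans ?_)) hL₁
        exact mul_le_mul_of_nonneg_left (by linarith) hM2
      _ = _ := by ring
  have hΘ : |θ p - τ p| ≤ L₂ * S * (p - a) := by
    rw [(hy p (hs1 hp)).2.2.2.2, (hx p (hs2 hp)).2.2.2.2, add_sub_add_left_eq_sub,
      ← intervalIntegral.integral_sub (hI hGy hb1) (hI hGx hb2), ← hpa, ← Real.norm_eq_abs]
    refine intervalIntegral.norm_integral_le_of_norm_le_const fun s hs => ?_
    have hs := hpT s hs
    obtain ⟨hy1, hy2, -⟩ := hy s (hs1 hs)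
    obtain ⟨hx1, hx2, -⟩ := hx s (hs2 hs)
    exact (hgL s ⟨(hIα s hs).1, (hIα s hs).2.trans hαT⟩ (y s) (x s) (θ s) (τ s)
      hy1 hx1 hy2 hx2).trans (mul_le_mul_of_nonneg_left (hDS s hs) hL₂)
  have hSz : S = 0 := by
    have h1 : S ≤ C * S * (p - a) := by
      rw [hC]; nlinarith
    have h2 : C * S * (p - a) ≤ C * S * (b - a) :=
      mul_le_mul_of_nonneg_left (by linarith [hp.2]) (by positivity)
    nlinarith
  refine ⟨b, hab, hb2.trans hb₂α, fun t ht => ?_⟩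
  rcases le_or_gt t a with h | h
  · exact hagree t h
  · have h1 := hDS t ⟨h.le, ht⟩
    rw [hSz] at h1
    have h2 := norm_nonneg (y t - x t)
    have h3 := abs_nonneg (θ t - τ t)
    exact ⟨sub_eq_zero.1 (norm_eq_zero.1 (by linarith)),
      sub_eq_zero.1 (abs_eq_zero.1 (by linarith))⟩

/-- Agreement of two solutions before a time `c` extends to `c`. -/
lemma IsIIVPSol.agree_at (X : IsIIVPSol n K f g Imp φ lam tI α x τ)
    (Y : IsIIVPSol n K f g Imp φ lam tI α y θ) (htm : Tendsto tm atTop atBot)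
    (hpos : ∀ t ∈ Icc 0 α, 0 ≤ τ t) {c : ℝ} (hc : 0 < c) (hcα : c ≤ α)
    (hagree : ∀ t < c, y t = x t ∧ θ t = τ t) : y c = x c ∧ θ c = τ c := by
  have hne : ∀ᵐ s : ℝ, s ∉ ({c} : Set ℝ) := (countable_singleton c).ae_notMem _
  constructor
  · by_cases himp : ∃ k, 1 ≤ k ∧ k ≤ K ∧ tI k = c
    · obtain ⟨k, h1, h2, rfl⟩ := himp
      obtain ⟨ξ, hξ, hx⟩ := X.2.2.2.2.2.1 k h1 h2 hcα
      obtain ⟨η, hη, hy⟩ := Y.2.2.2.2.2.1 k h1 h2 hcα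
      have : η = ξ := tendsto_nhds_unique hη (hξ.congr'
        (eventually_nhdsWithin_of_forall fun s hs => (hagree s hs).1.symm))
      rw [hx, hy, this]
    · obtain ⟨δ, hδ, hgap⟩ := exists_gap (finite_breakpoints_inter_Ici K tI htm) c
      obtain ⟨a, ha, hac⟩ := exists_between (show max 0 (c - δ) < c from
        max_lt hc (by linarith))
      have ha0 := (le_max_left _ _).trans_lt ha
      have haδ := (le_max_right _ _).trans_lt ha
      have hno : ∀ k, 1 ≤ k → k ≤ K → tI k ∉ Ioc a c := fun k h1 h2 hk =>
        himp ⟨k, h1, h2, hgap _ (Or.inl ⟨k, ⟨h1, h2⟩, rfl⟩)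
          ⟨by linarith [hk.1], by linarith [hk.2]⟩⟩
      rw [X.2.2.2.2.2.2 a c ha0.le hac.le hcα hno, Y.2.2.2.2.2.2 a c ha0.le hac.le hcα hno,
        (hagree a hac).1]
      congr 1
      refine intervalIntegral.integral_congr_ae ?_
      filter_upwards [hne] with s hsc hs
      rw [uIoc_of_le hac.le] at hs
      have hs' : s < c := hs.2.lt_of_ne hsc
      have := hpos s ⟨by linarith [hs.1], by linarith⟩
      rw [(hagree s hs').1, (hagree s hs').2, (hagree (s - τ s) (by linarith)).1]
  · rw [X.2.2.2.1 c ⟨hc.le, hcα⟩, Y.2.2.2.1 c ⟨hc.le, hcα⟩]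
    congr 1
    refine intervalIntegral.integral_congr_ae ?_
    filter_upwards [hne] with s hsc hs
    rw [uIoc_of_le hc.le] at hs
    have hs' : s < c := hs.2.lt_of_ne hsc
    rw [(hagree s hs').1, (hagree s hs').2]

/-- Every solution agrees with a regular one. -/
theorem IsRegularSol.unique (R : IsRegularSol n K f g Imp φ lam tI tm M1 M2 M3 α x τ)
    (Y : IsIIVPSol n K f g Imp φ lam tI α y θ)
    (hf : AssumptionA1 n T f) (hg : AssumptionA2 n T g) (hα : 0 < α) (hαT : α ≤ T)
    (htm : Tendsto tm atTop atBot) (hlamM : lam ≤ M1) (hM1 : 0 ≤ M1) (hM2 : 0 ≤ M2)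
    (hg1 : ∀ t ∈ Icc 0 α, ∀ u, ‖u‖ ≤ M1 → ∀ w ∈ Icc 0 M1, g t u w < 1) :
    ∀ t ≤ α, y t = x t ∧ θ t = τ t := by
  have hbdd : BddAbove {b | b ∈ Icc 0 α ∧ ∀ t ≤ b, y t = x t ∧ θ t = τ t} :=
    ⟨α, fun b hb => hb.1.2⟩
  have h0 : (0 : ℝ) ∈ {b | b ∈ Icc 0 α ∧ ∀ t ≤ b, y t = x t ∧ θ t = τ t} :=
    ⟨⟨le_rfl, hα.le⟩, fun t ht => ⟨by rw [Y.1 t ht, R.isSol.1 t ht],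
      by rw [Y.2.1 t ht, R.isSol.2.1 t ht]⟩⟩
  obtain ⟨c, hc⟩ : ∃ c, c = sSup {b | b ∈ Icc 0 α ∧ ∀ t ≤ b, y t = x t ∧ θ t = τ t} := ⟨_, rfl⟩
  have hc0 : 0 ≤ c := hc ▸ le_csSup hbdd h0
  have hcα : c ≤ α := hc ▸ csSup_le ⟨0, h0⟩ fun b hb => hb.1.2
  have hlt : ∀ t < c, y t = x t ∧ θ t = τ t := by
    intro t ht
    obtain ⟨b, hb, htb⟩ := exists_lt_of_lt_csSup ⟨0, h0⟩ (hc ▸ ht)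
    exact hb.2 t htb.le
  have hle : ∀ t ≤ c, y t = x t ∧ θ t = τ t := by
    intro t ht
    rcases eq_or_lt_of_le ht with rfl | h
    · rcases eq_or_lt_of_le hc0 with h | h
      · exact h0.2 t h.ge
      · exact R.isSol.agree_at Y htm (fun t ht => (R.pos t ht).le) h hcα hlt
    · exact hlt t h
  rcases eq_or_lt_of_le hcα with h | h
  · exact h ▸ hle
  · obtain ⟨b, hb, hbα, hagree⟩ :=
      R.exists_agree_right Y hf hg hαT htm hlamM hM1 hM2 hg1 hc0 h hle
    have : b ≤ c := hc ▸ le_csSup hbdd ⟨⟨hc0.trans hb.le, hbα⟩, hagree⟩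
    linarith

end Uniqueness

/-- Theorem 3.3: assume (A1)–(A4), `λ > 0`, let `α`, `h*`, `M₁`, `M₂`, `M₃`
be the constants provided by the lemma on the EPCA approximate solutions
(their defining properties are listed as hypotheses), and assume moreover
that `g(t,u,w) < 1` for `t ∈ [0,α]`, `‖u‖ ≤ M₁`, `w ∈ [0,M₁]`. Then the
impulsive initial value problem has a unique solution `(x,τ)` on `(-∞,α]`,
and it satisfies `τ > 0` on `[0,α]`, `‖x(t)‖ + τ(t) ≤ M₁` on `(-∞,α]`, the
Lipschitz estimate with constant `M₂` on each interval between consecutive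
points of `{-λ, …, tm 1, 0, tI 1, …, tI k₀, α}`, and the Lipschitz estimate
with constant `M₃` for `τ` on `[0,α]`. -/
theorem stmt4 (n K : ℕ) (T lam : ℝ) (hT : 0 < T) (hlam : 0 < lam)
    (f : ℝ → (Fin n → ℝ) → (Fin n → ℝ) → (Fin n → ℝ))
    (g : ℝ → (Fin n → ℝ) → ℝ → ℝ) (Imp : ℕ → (Fin n → ℝ) → (Fin n → ℝ))
    (φ : ℝ → (Fin n → ℝ)) (tm : ℕ → ℝ)
    (hA1 : AssumptionA1 n T f) (hA2 : AssumptionA2 n T g)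
    (hA3 : AssumptionA3 n K Imp) (hA4 : AssumptionA4 n φ tm)
    (tI : ℕ → ℝ) (htI0 : tI 0 = 0) (htIK : tI (K + 1) = T)
    (htImono : ∀ k ≤ K, tI k < tI (k + 1))
    (h0 : ℝ) (hh0min : ∀ k ≤ K, h0 ≤ tI (k + 1) - tI k)
    (hh0mem : ∃ k ≤ K, h0 = tI (k + 1) - tI k)
    -- the constants provided by the lemma on the EPCA approximate solutions:
    (hstar α M1 M2 M3 : ℝ)
    (hhstar : 0 < hstar) (hstarh0 : hstar ≤ h0)
    (hα0 : 0 < α) (hαT : α ≤ T) (hαimp : ∀ k, 1 ≤ k → k ≤ K → α ≠ tI k)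
    (hM1 : 0 ≤ M1) (hM2 : 0 ≤ M2) (hM3 : 0 ≤ M3)
    (hEPCA : ∀ h : ℝ, 0 < h → h < hstar →
      (∃ x τ, IsEPCASol n K f g Imp φ lam tI h α x τ ∧
        (∀ t ∈ Icc (0 : ℝ) α, 0 < τ t) ∧
        (∀ t ≤ α, ‖x t‖ + τ t < M1) ∧
        (∀ k ≤ K, ∀ t ∈ Ico (tI k) (tI (k + 1)) ∩ Icc 0 α,
          ∀ tb ∈ Ico (tI k) (tI (k + 1)) ∩ Icc 0 α,
            ‖x t - x tb‖ ≤ M2 * |t - tb|) ∧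
        (∀ k : ℕ, ∀ t ∈ Ico (tm (k + 1)) (tm k) ∩ Icc (-M1) 0,
          ∀ tb ∈ Ico (tm (k + 1)) (tm k) ∩ Icc (-M1) 0,
            ‖x t - x tb‖ ≤ M2 * |t - tb|) ∧
        (∀ t ∈ Icc (0 : ℝ) α, ∀ tb ∈ Icc (0 : ℝ) α,
            |τ t - τ tb| ≤ M3 * |t - tb|)) ∧
      (∀ x1 τ1 x2 τ2,
        IsEPCASol n K f g Imp φ lam tI h α x1 τ1 →
        IsEPCASol n K f g Imp φ lam tI h α x2 τ2 →
        ∀ t ≤ α, x1 t = x2 t ∧ τ1 t = τ2 t))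
    -- the extra hypothesis (3.13): the delayed time function is increasing
    (hg1 : ∀ t ∈ Icc (0 : ℝ) α, ∀ u : Fin n → ℝ, ‖u‖ ≤ M1 →
      ∀ w ∈ Icc (0 : ℝ) M1, g t u w < 1) :
    ∃ x τ, IsIIVPSol n K f g Imp φ lam tI α x τ ∧
      (∀ t ∈ Icc (0 : ℝ) α, 0 < τ t) ∧
      (∀ t ≤ α, ‖x t‖ + τ t ≤ M1) ∧
      (∀ t ∈ Icc (-lam) α, ∀ tb ∈ Icc (-lam) α, t ≤ tb →
        (∀ k, 1 ≤ k → k ≤ K → tI k ∉ Ioc t tb) →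
        (∀ k : ℕ, tm k ∉ Ioc t tb) →
        ‖x tb - x t‖ ≤ M2 * |tb - t|) ∧
      (∀ t ∈ Icc (0 : ℝ) α, ∀ tb ∈ Icc (0 : ℝ) α,
          |τ t - τ tb| ≤ M3 * |t - tb|) ∧
      (∀ x' τ', IsIIVPSol n K f g Imp φ lam tI α x' τ' →
        ∀ t ≤ α, x' t = x t ∧ τ' t = τ t) := by
  have hrange : ∀ j : ℕ, 0 < hstar / (j + 2) ∧ hstar / (j + 2) < hstar := fun j => by
    have hj : (0 : ℝ) ≤ j := j.cast_nonneg
    refine ⟨by positivity, ?_⟩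
    rw [div_lt_iff₀ (by positivity)]
    nlinarith
  have hlim : Tendsto (fun j : ℕ => hstar / ((j : ℝ) + 2)) atTop (nhds 0) :=
    tendsto_const_nhds.div_atTop (tendsto_natCast_atTop_atTop.atTop_add tendsto_const_nhds)
  choose X Θ hsol hpos hbound hLip hLip' hLipΘ using
    fun j : ℕ => (hEPCA (hstar / (j + 2)) (hrange j).1 (hrange j).2).1
  obtain ⟨htm0, hanti, htm, -⟩ := hA4
  have htI : ∀ k, k ≤ K → 0 < tI (k + 1) := by
    intro k
    induction k with
    | zero => exact fun hk => htI0 ▸ htImono 0 hk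
    | succ k ih => exact fun hk => (ih (by omega)).trans (htImono (k + 1) hk)
  have htI' : ∀ k, 1 ≤ k → k ≤ K → 0 < tI k := fun k h1 hk => by
    obtain ⟨k, rfl⟩ := Nat.exists_eq_add_of_le' h1
    exact htI k (by omega)
  have hαB : α ∉ breakpoints K tI tm := by
    rintro (⟨k, hk, hkα⟩ | ⟨k, hkα⟩)
    · exact hαimp k hk.1 hk.2 hkα.symm
    · have := hanti.antitone k.zero_le
      linarith
  have hΘ0 : ∀ j, ∀ t ≤ α, 0 < Θ j t := fun j t ht => by
    rcases le_or_gt t 0 with h | h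
    · rw [(hsol j).2.1 t h]; exact hlam
    · exact hpos j t ⟨h.le, ht⟩
  have hnorm : ∀ j, ∀ t ≤ α, ‖X j t‖ ≤ M1 := fun j t ht => by
    linarith [hbound j t ht, hΘ0 j t ht]
  have hlamM : lam < M1 := by
    have h1 := hbound 0 0 hα0.le
    rw [(hsol 0).2.1 0 le_rfl] at h1
    linarith [norm_nonneg (X 0 0)]
  have hLO : ∀ j, LipschitzOff (breakpoints K tI tm) M2 (-M1) α (X j) := fun j =>
    (hsol j).lipschitzOff (hrange j).1 hA1 htm0 htm htI0 htIK hαT hM2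
      (fun t ht => (hpos j t ht).le) (hnorm j) (hLip j) (hLip' j)
  obtain ⟨ψ, x, τ, hψ, hconv⟩ := exists_subseq_tendsto
    (finite_breakpoints_inter_Ici K tI htm) (neg_nonpos.2 hM1) hα0 hαB hM2 hM3
    (fun j => (hsol j).1) (fun j => (hsol j).2.1) hLO hLipΘ hnorm (fun j t ht => by
      rw [abs_of_pos (hΘ0 j t ht)]
      linarith [hbound j t ht, norm_nonneg (X j t)])
  have H : IsApproximated n K f g Imp φ lam tI tm M1 M2 M3 α
      (fun j => hstar / ((ψ j : ℝ) + 2)) (fun j => X (ψ j)) (fun j => Θ (ψ j))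
      (fun t => x (min t α)) τ :=
    { step_pos := fun j => (hrange (ψ j)).1
      step_lim := hlim.comp hψ.tendsto_atTop
      isSol := fun j => hsol (ψ j)
      pos := fun j => hpos (ψ j)
      bound := fun j t ht => (hbound (ψ j) t ht).le
      lip := fun j => hLO (ψ j)
      lipDelay := fun j => hLipΘ (ψ j)
      tendsto := fun t ht => by
        simp only [min_eq_left ht]
        exact (hconv t ht).1
      tendstoDelay := fun t ht => (hconv t ht).2 }
  have R := H.isRegularSol hA1 hA2 hA3 htm htI' hlam hlamM hα0 hαT hM2 hM3
    (fun t ht => by simp only [min_eq_right ht, min_self]) hg1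
  refine ⟨_, _, R.isSol, R.pos, R.bound, fun t ht tb htb htt hk hm => ?_, R.lipDelay,
    fun y θ Y => R.unique Y hA1 hA2 hα0 hαT htm hlamM.le hM1 hM2 hg1⟩
  rw [abs_of_nonneg (sub_nonneg.2 htt)]
  refine R.lip t tb (by linarith [ht.1]) htt htb.2 ?_
  rintro _ (⟨k, hk', rfl⟩ | ⟨k, rfl⟩)
  · exact hk k hk'.1 hk'.2
  · exact hm k
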